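/- arXiv:1107.3000 — 12 statements merged into one kernel-verified Lean document; each statement's English description precedes it below -/
import Mathlib

section
/- Let R be a commutative ring, let A be a 2×2 matrix over R, and let u be a unimodular row of length 2 over R. Then u belongs to the R-submodule of R² generated by the two rows of A if and only if there exists an invertible 2×2 matrix P over R such that u is the first row of P·A. -/
/-- A unimodular row `u` of length 2 lies in the row space of a 2×2 matrix `A`
iff `u` is the first row of `P * A` for some invertible matrix `P`. -/
theorem unimodular_row_mem_rowSpace_iff
    {R : Type*} [CommRing R] (A : Matrix (Fin 2) (Fin 2) R) (u : Fin 2 → R)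
    (hu : Ideal.span {u 0, u 1} = ⊤) :
    u ∈ Submodule.span R ({A 0, A 1} : Set (Fin 2 → R)) ↔
      ∃ P : Matrix (Fin 2) (Fin 2) R, IsUnit P ∧ (P * A) 0 = u := by
  rw [Submodule.mem_span_pair]
  constructor
  · rintro ⟨a, b, h⟩
    have h1 : (1 : R) ∈ Ideal.span {u 0, u 1} := by rw [hu]; trivial
    obtain ⟨r, s, hrs⟩ := Ideal.mem_span_pair.mp h1
    have e0 : a * A 0 0 + b * A 1 0 = u 0 := by simpa using congrFun h 0
    have e1 : a * A 0 1 + b * A 1 1 = u 1 := by simpa using congrFun h 1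
    refine ⟨!![a, b; -(r * A 1 0 + s * A 1 1), r * A 0 0 + s * A 0 1], ?_, ?_⟩
    · rw [Matrix.isUnit_iff_isUnit_det, Matrix.det_fin_two_of]
      convert isUnit_one (M := R)
      rw [← hrs, ← e0, ← e1]
      ring
    · ext j
      fin_cases j
      · simpa [Matrix.mul_apply, Fin.sum_univ_two] using e0
      · simpa [Matrix.mul_apply, Fin.sum_univ_two] using e1
  · rintro ⟨P, -, h⟩
    refine ⟨P 0 0, P 0 1, ?_⟩
    rw [← h]
    ext j
    simp [Matrix.mul_apply, Fin.sum_univ_two]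
end

section
/- Let A be a 2×2 matrix over a commutative ring R whose four entries generate the unit ideal of R. Then A is equivalent to a diagonal matrix if and only if the R-submodule of R² generated by the two rows of A contains a unimodular row; moreover, in this case A is equivalent to a diagonal matrix of the form diag(1, d) for some d ∈ R. -/
/-- Two matrices are equivalent if one is obtained from the other by
multiplication by invertible matrices on both sides. -/
def MatEquiv {R : Type*} [CommRing R] {m n : ℕ}
    (A B : Matrix (Fin m) (Fin n) R) : Prop :=
  ∃ P : Matrix (Fin m) (Fin m) R, ∃ Q : Matrix (Fin n) (Fin n) R,
    IsUnit P ∧ IsUnit Q ∧ B = P * A * Q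

theorem aux_forward {R : Type*} [CommRing R] (A : Matrix (Fin 2) (Fin 2) R)
    (h : ∃ u : Fin 2 → R, u ∈ Submodule.span R ({A 0, A 1} : Set (Fin 2 → R)) ∧
        Ideal.span {u 0, u 1} = ⊤) :
    ∃ d : R, MatEquiv A (Matrix.diagonal ![1, d]) := by
  obtain ⟨u, hu, hs⟩ := h
  obtain ⟨x, y, rfl⟩ := Submodule.mem_span_pair.1 hu
  rw [Ideal.eq_top_iff_one, Ideal.mem_span_pair] at hs
  obtain ⟨v, w, h⟩ := hs
  simp only [Pi.add_apply, Pi.smul_apply, smul_eq_mul] at h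
  refine ⟨A 0 0 * A 1 1 - A 0 1 * A 1 0,
    !![x, y; -(A 1 0 * v + A 1 1 * w), A 0 0 * v + A 0 1 * w],
    !![v, -(x * A 0 1 + y * A 1 1); w, x * A 0 0 + y * A 1 0], ?_, ?_, ?_⟩
  · rw [Matrix.isUnit_iff_isUnit_det, Matrix.det_fin_two_of]
    convert isUnit_one using 1
    linear_combination h
  · rw [Matrix.isUnit_iff_isUnit_det, Matrix.det_fin_two_of]
    convert isUnit_one using 1
    linear_combination h
  · ext i j
    fin_cases i <;> fin_cases j <;>
      simp [Matrix.mul_apply, Matrix.vecMul, dotProduct, Fin.sum_univ_two, Matrix.diagonal]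
    · linear_combination -h
    · ring
    · ring
    · linear_combination -(A 0 0 * A 1 1 - A 0 1 * A 1 0) * h

theorem aux_backward {R : Type*} [CommRing R] (A : Matrix (Fin 2) (Fin 2) R)
    (hA : Ideal.span {A 0 0, A 0 1, A 1 0, A 1 1} = ⊤)
    (h : ∃ d : Fin 2 → R, MatEquiv A (Matrix.diagonal d)) :
    ∃ u : Fin 2 → R, u ∈ Submodule.span R ({A 0, A 1} : Set (Fin 2 → R)) ∧
        Ideal.span {u 0, u 1} = ⊤ := by
  obtain ⟨d, P, Q, hP, hQ, hD⟩ := h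
  obtain ⟨P', hP'⟩ := hP.exists_left_inv
  obtain ⟨Q', hQ'⟩ := hQ.exists_right_inv
  have hA' : A = P' * Matrix.diagonal d * Q' := by
    rw [hD]
    calc A = (P' * P) * A * (Q * Q') := by rw [hP', hQ', one_mul, mul_one]
      _ = _ := by simp only [Matrix.mul_assoc]
  have hmem : ∀ i j, A i j ∈ Ideal.span {d 0, d 1} := by
    intro i j
    rw [Ideal.mem_span_pair, hA']
    refine ⟨P' i 0 * Q' 0 j, P' i 1 * Q' 1 j, ?_⟩
    simp [Matrix.mul_apply, Fin.sum_univ_two, Matrix.diagonal]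
    ring
  have htop : (1 : R) ∈ Ideal.span {d 0, d 1} := by
    have hle : Ideal.span {A 0 0, A 0 1, A 1 0, A 1 1} ≤ Ideal.span {d 0, d 1} := by
      rw [Ideal.span_le]
      rintro z (rfl | rfl | rfl | rfl) <;> exact hmem _ _
    rw [hA] at hle
    exact hle trivial
  obtain ⟨a, b, hab⟩ := Ideal.mem_span_pair.1 htop
  refine ⟨(P 0 0 + P 1 0) • A 0 + (P 0 1 + P 1 1) • A 1,
    Submodule.mem_span_pair.2 ⟨_, _, rfl⟩, ?_⟩
  rw [Ideal.eq_top_iff_one, Ideal.mem_span_pair]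
  refine ⟨Q 0 0 * a + Q 0 1 * b, Q 1 0 * a + Q 1 1 * b, ?_⟩
  have e := fun i j => congrFun (congrFun hD i) j
  have e00 := e 0 0
  have e01 := e 0 1
  have e10 := e 1 0
  have e11 := e 1 1
  simp [Matrix.mul_apply, Fin.sum_univ_two, Matrix.diagonal] at e00 e01 e10 e11
  simp only [Pi.add_apply, Pi.smul_apply, smul_eq_mul]
  linear_combination hab - a * e00 - a * e10 - b * e01 - b * e11

/-- A 2×2 matrix whose entries generate the unit ideal is equivalent to a
diagonal matrix iff its row space contains a unimodular row; moreover, in this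
case it is equivalent to `diag(1, d)` for some `d`. -/
theorem matrix_diag_reduction_iff_unimodular_row
    {R : Type*} [CommRing R] (A : Matrix (Fin 2) (Fin 2) R)
    (hA : Ideal.span {A 0 0, A 0 1, A 1 0, A 1 1} = ⊤) :
    ((∃ d : Fin 2 → R, MatEquiv A (Matrix.diagonal d)) ↔
      (∃ u : Fin 2 → R, u ∈ Submodule.span R ({A 0, A 1} : Set (Fin 2 → R)) ∧
        Ideal.span {u 0, u 1} = ⊤)) ∧
    ((∃ u : Fin 2 → R, u ∈ Submodule.span R ({A 0, A 1} : Set (Fin 2 → R)) ∧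
        Ideal.span {u 0, u 1} = ⊤) →
      ∃ d : R, MatEquiv A (Matrix.diagonal ![1, d])) := by
  exact ⟨⟨aux_backward A hA, fun h => (aux_forward A h).imp' (fun d => ![1, d]) fun _ h => h⟩,
    aux_forward A⟩
end

section
/- Let R be a commutative ring and let a, b, c ∈ R with (a, b, c) = (1). Then the triangular 2×2 matrix with rows [a, b] and [0, c] is equivalent to a diagonal matrix over R if and only if there exist elements p, q ∈ R such that (p·a, p·b + q·c) = (1). -/
/-- Kaplansky's criterion: the matrix `!![a, b; 0, c]` with `(a,b,c) = (1)`
admits a diagonal reduction iff there are `p, q` with `(p·a, p·b + q·c) = (1)`. -/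
theorem triangular_matrix_diag_reduction_iff_kaplansky
    {R : Type*} [CommRing R] (a b c : R)
    (habc : Ideal.span {a, b, c} = ⊤) :
    (∃ d : Fin 2 → R, MatEquiv !![a, b; 0, c] (Matrix.diagonal d)) ↔
      ∃ p q : R, Ideal.span {p * a, p * b + q * c} = ⊤ := by
  constructor
  · rintro ⟨d, P, Q, hP, hQ, h⟩
    obtain ⟨P', hP'⟩ := hP.exists_left_inv
    obtain ⟨Q', hQ'⟩ := hQ.exists_right_inv
    have hA : !![a, b; 0, c] = P' * Matrix.diagonal d * Q' := by
      rw [h]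
      calc !![a, b; 0, c] = (P' * P) * !![a, b; 0, c] * (Q * Q') := by rw [hP', hQ']; simp
        _ = _ := by simp only [Matrix.mul_assoc]
    have e00 := congrFun (congrFun hA 0) 0
    have e01 := congrFun (congrFun hA 0) 1
    have e11 := congrFun (congrFun hA 1) 1
    have f00 := congrFun (congrFun h 0) 0
    have f01 := congrFun (congrFun h 0) 1
    have f10 := congrFun (congrFun h 1) 0
    have f11 := congrFun (congrFun h 1) 1
    simp [Matrix.mul_apply, Fin.sum_univ_two, Matrix.diagonal] at e00 e01 e11 f00 f01 f10 f11
    have hd : ∃ x y, x * d 0 + y * d 1 = 1 := by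
      rw [← Ideal.mem_span_pair, ← Ideal.eq_top_iff_one, eq_top_iff, ← habc, Ideal.span_le]
      rintro z (rfl | rfl | rfl) <;> rw [SetLike.mem_coe, Ideal.mem_span_pair]
      · exact ⟨P' 0 0 * Q' 0 0, P' 0 1 * Q' 1 0, by rw [e00]; ring⟩
      · exact ⟨P' 0 0 * Q' 0 1, P' 0 1 * Q' 1 1, by rw [e01]; ring⟩
      · exact ⟨P' 1 0 * Q' 0 1, P' 1 1 * Q' 1 1, by rw [e11]; ring⟩
    obtain ⟨x, y, hxy⟩ := hd
    refine ⟨P 0 0 + P 1 0, P 0 1 + P 1 1, ?_⟩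
    rw [Ideal.eq_top_iff_one, Ideal.mem_span_pair]
    refine ⟨Q 0 0 * x + Q 0 1 * y, Q 1 0 * x + Q 1 1 * y, ?_⟩
    linear_combination hxy - x * f00 - y * f01 - x * f10 - y * f11
  · rintro ⟨p, q, h⟩
    rw [Ideal.eq_top_iff_one, Ideal.mem_span_pair] at h
    obtain ⟨s, t, h⟩ := h
    refine ⟨![1, a * c], !![p, q; -(c * t), a * s + b * t],
      !![s, -(p * b + q * c); t, p * a], ?_, ?_, ?_⟩
    · rw [Matrix.isUnit_iff_isUnit_det, Matrix.det_fin_two_of]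
      convert isUnit_one
      linear_combination h
    · rw [Matrix.isUnit_iff_isUnit_det, Matrix.det_fin_two_of]
      convert isUnit_one
      linear_combination h
    · ext i j
      fin_cases i <;> fin_cases j <;>
        simp [Matrix.mul_apply, Fin.sum_univ_two, Matrix.diagonal]
      · linear_combination -h
      · ring
      · ring
      · linear_combination -(a * c) * h
end

section
/- Let R be a commutative ring and let a, b, c ∈ R with (a, b, c) = (1). If there exist p, q ∈ R with (p·a, p·b + q·c) = (1), then there exist elements λ, u, v ∈ R such that b + λ·c = u·v, (u, a) = (1), (v, c) = (1), and moreover (u, v) = (1). -/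
/-- Kaplansky's condition implies the factorization condition (2) ⟹ (4)
of Proposition on variants of the Kaplansky condition. -/
theorem kaplansky_implies_factorization
    {R : Type*} [CommRing R] (a b c : R)
    (habc : Ideal.span {a, b, c} = ⊤)
    (h : ∃ p q : R, Ideal.span {p * a, p * b + q * c} = ⊤) :
    ∃ lam u v : R, b + lam * c = u * v ∧
      Ideal.span {u, a} = ⊤ ∧ Ideal.span {v, c} = ⊤ ∧
      Ideal.span {u, v} = ⊤ := by
  obtain ⟨p, q, h⟩ := h
  simp only [Ideal.eq_top_iff_one, Ideal.mem_span_pair] at h ⊢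
  obtain ⟨r, t, h⟩ := h
  -- `v` is an inverse of `p` modulo `c * (p * b + q * c)`
  obtain ⟨v, hv⟩ : ∃ v, v = r * a + t * b + r * a * t * q * c := ⟨_, rfl⟩
  have hvp : v * p = 1 - t ^ 2 * q * c * (p * b + q * c) := by
    rw [hv]
    linear_combination (1 + t * q * c) * h
  refine ⟨v * q - t ^ 2 * q * (p * b + q * c) * b, p * b + q * c, v, ?_,
    ⟨t, r * p, ?_⟩, ⟨p, t ^ 2 * q * (p * b + q * c), ?_⟩, ⟨t ^ 2 * q * c, p, ?_⟩⟩
  · linear_combination (-b) * hvp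
  · linear_combination h
  · linear_combination hvp
  · linear_combination hvp
end

section
/- Let R be a commutative ring and let a, b, c ∈ R with (a, b, c) = (1). If there exist elements λ, u, v ∈ R such that b + λ·c = u·v with (u, a) = (1) and (v, c) = (1), then there exist elements p, q ∈ R such that (p·b + q·c, a) = (1) and (p, c) = (1). -/
/-- The factorization condition implies condition (3): (4) ⟹ (3)
of Proposition on variants of the Kaplansky condition. -/
theorem factorization_implies_condition_three
    {R : Type*} [CommRing R] (a b c : R)
    (habc : Ideal.span {a, b, c} = ⊤)
    (h : ∃ lam u v : R, b + lam * c = u * v ∧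
      Ideal.span {u, a} = ⊤ ∧ Ideal.span {v, c} = ⊤) :
    ∃ p q : R, Ideal.span {p * b + q * c, a} = ⊤ ∧ Ideal.span {p, c} = ⊤ := by
  obtain ⟨lam, u, v, hb, hu, hv⟩ := h
  rw [Ideal.eq_top_iff_one, Ideal.mem_span_pair] at hv
  obtain ⟨p, t, hpt⟩ := hv
  refine ⟨p, u * t + p * lam, ?_, ?_⟩
  · have e : p * b + (u * t + p * lam) * c = u := by
      linear_combination p * hb + u * hpt
    rw [e]
    exact hu
  · rw [Ideal.eq_top_iff_one, Ideal.mem_span_pair]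
    exact ⟨v, t, by rw [mul_comm v p]; exact hpt⟩
end

section
/- Let R be a K-Hermite commutative ring and let a, b, c ∈ R with (a, b, c) = (1). If there exist elements p, q ∈ R such that (p·b + q·c, a) = (1) and (p, c) = (1), then there exist elements p₁, q₁ ∈ R such that (p₁·a, p₁·b + q₁·c) = (1). -/
/-- A commutative ring is K-Hermite (elementwise Henriksen condition). -/
def IsKHermite (R : Type*) [CommRing R] : Prop :=
  ∀ a b : R, ∃ d a₁ b₁ : R, Ideal.span {a₁, b₁} = ⊤ ∧
    d = a₁ * a + b₁ * b ∧ Ideal.span {d} = Ideal.span {a, b}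

/-- In a K-Hermite ring, condition (3) implies Kaplansky's condition (2). -/
theorem condition_three_implies_kaplansky
    {R : Type*} [CommRing R] (hKH : IsKHermite R) (a b c : R)
    (habc : Ideal.span {a, b, c} = ⊤)
    (h : ∃ p q : R, Ideal.span {p * b + q * c, a} = ⊤ ∧ Ideal.span {p, c} = ⊤) :
    ∃ p₁ q₁ : R, Ideal.span {p₁ * a, p₁ * b + q₁ * c} = ⊤ := by
  have key : ∀ r s : R, Ideal.span {r, s} = ⊤ ↔ IsCoprime r s := by
    intro r s
    rw [Ideal.eq_top_iff_one, Ideal.mem_span_pair]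
    rfl
  obtain ⟨p, q, h1, h2⟩ := h
  obtain ⟨d, x, y, hxy, hd, hspan⟩ := hKH p q
  rw [key] at h1 h2 hxy
  have hp : d ∣ p := by
    rw [← Ideal.mem_span_singleton, hspan]
    exact Ideal.subset_span (by simp)
  have hq : d ∣ q := by
    rw [← Ideal.mem_span_singleton, hspan]
    exact Ideal.subset_span (by simp)
  obtain ⟨u, hu⟩ := hp
  obtain ⟨v, hv⟩ := hq
  obtain ⟨s, t, hst⟩ := hxy
  have hw : d * (1 - x * u - y * v) = 0 := by
    have : d = x * (d * u) + y * (d * v) := by rw [← hu, ← hv]; exact hd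
    linear_combination this
  obtain ⟨u', hu'⟩ : ∃ u', u' = u + s * (1 - x * u - y * v) := ⟨_, rfl⟩
  obtain ⟨v', hv'⟩ : ∃ v', v' = v + t * (1 - x * u - y * v) := ⟨_, rfl⟩
  have hpu : p = d * u' := by rw [hu', hu]; linear_combination (-s) * hw
  have hqv : q = d * v' := by rw [hv', hv]; linear_combination (-t) * hw
  have huv : IsCoprime u' v' := by
    refine ⟨x, y, ?_⟩
    rw [hu', hv']
    linear_combination (1 - x * u - y * v) * hst
  have huc : IsCoprime u' c := h2.of_isCoprime_of_dvd_left ⟨d, by rw [hpu]; ring⟩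
  have ha : IsCoprime (u' * b + v' * c) a :=
    h1.of_isCoprime_of_dvd_left ⟨d, by rw [hpu, hqv]; ring⟩
  refine ⟨u', v', ?_⟩
  rw [key]
  refine IsCoprime.mul_left ?_ ha.symm
  have := huv.mul_right huc
  obtain ⟨e, f, hef⟩ := this
  exact ⟨e - f * b, f, by linear_combination hef⟩
end

section
/- Let R be a K-Hermite commutative ring, and let a, b, c ∈ R with (a, b, c) = (1). Then the following four conditions are equivalent: (1) the 2×2 matrix with rows [a, b] and [0, c] is equivalent to a diagonal matrix; (2) there exist p, q ∈ R with (p·a, p·b + q·c) = (1); (3) there exist p, q ∈ R with (p·b + q·c, a) = (1) and (p, c) = (1); (4) there exist λ, u, v ∈ R with b + λ·c = u·v, (u, a) = (1), and (v, c) = (1). Moreover, in condition (4) the elements u and v may be chosen so that additionally (u, v) = (1). -/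
theorem span_pair_top_iff {R : Type*} [CommRing R] (a b : R) :
    Ideal.span {a, b} = ⊤ ↔ ∃ x y : R, x * a + y * b = 1 := by
  rw [Ideal.eq_top_iff_one, Ideal.mem_span_pair]

theorem IsKHermite.factor {R : Type*} [CommRing R] (h : IsKHermite R) (a b : R) :
    ∃ d p q s t : R, a = d * p ∧ b = d * q ∧ s * p + t * q = 1 := by
  obtain ⟨d, a₁, b₁, h1, hd, hs⟩ := h a b
  obtain ⟨x, y, hxy⟩ := (span_pair_top_iff _ _).1 h1
  have ha : a ∈ Ideal.span {d} := hs ▸ Ideal.subset_span (by simp)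
  have hb : b ∈ Ideal.span {d} := hs ▸ Ideal.subset_span (by simp)
  obtain ⟨s, hs'⟩ := Ideal.mem_span_singleton'.1 ha
  obtain ⟨t, ht'⟩ := Ideal.mem_span_singleton'.1 hb
  have he : d * (x * t - y * s) = x * b - y * a := by
    linear_combination x * ht' - y * hs'
  refine ⟨d, x - b₁ * (x * t - y * s), y + a₁ * (x * t - y * s), a₁, b₁, ?_, ?_, ?_⟩
  · linear_combination b₁ * he - x * hd - a * hxy
  · linear_combination -a₁ * he - y * hd - b * hxy
  · linear_combination hxy

theorem diag_imp_two {R : Type*} [CommRing R] (a b c : R)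
    (habc : Ideal.span {a, b, c} = ⊤)
    (h : ∃ d : Fin 2 → R, MatEquiv !![a, b; 0, c] (Matrix.diagonal d)) :
    ∃ p q : R, Ideal.span {p * a, p * b + q * c} = ⊤ := by
  obtain ⟨d, P, Q, hP, hQ, h⟩ := h
  obtain ⟨P', hP'⟩ := hP.exists_left_inv
  obtain ⟨Q', hQ'⟩ := hQ.exists_right_inv
  have hA : !![a, b; 0, c] = P' * Matrix.diagonal d * Q' := by
    rw [h]
    calc !![a, b; 0, c] = 1 * !![a, b; 0, c] * 1 := by simp
      _ = (P' * P) * !![a, b; 0, c] * (Q * Q') := by rw [hP', hQ']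
      _ = _ := by simp only [Matrix.mul_assoc]
  rw [Ideal.eq_top_iff_one] at habc
  obtain ⟨x, y, z, hxyz⟩ := Submodule.mem_span_triple.1 habc
  have e00 := congrFun (congrFun h 0) 0
  have e01 := congrFun (congrFun h 0) 1
  have e10 := congrFun (congrFun h 1) 0
  have e11 := congrFun (congrFun h 1) 1
  have f00 := congrFun (congrFun hA 0) 0
  have f01 := congrFun (congrFun hA 0) 1
  have f11 := congrFun (congrFun hA 1) 1
  simp [Matrix.mul_apply, Fin.sum_univ_two, Matrix.diagonal] at e00 e01 e10 e11 f00 f01 f11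
  simp only [smul_eq_mul] at hxyz
  refine ⟨P 0 0 + P 1 0, P 0 1 + P 1 1, ?_⟩
  rw [span_pair_top_iff]
  let X := x * (P' 0 0 * Q' 0 0) + y * (P' 0 0 * Q' 0 1) + z * (P' 1 0 * Q' 0 1)
  let Y := x * (P' 0 1 * Q' 1 0) + y * (P' 0 1 * Q' 1 1) + z * (P' 1 1 * Q' 1 1)
  have hXY : X * d 0 + Y * d 1 = 1 := by
    simp only [X, Y]
    linear_combination hxyz - x * f00 - y * f01 - z * f11
  refine ⟨X * Q 0 0 + Y * Q 0 1, X * Q 1 0 + Y * Q 1 1, ?_⟩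
  linear_combination hXY - X * e00 - X * e10 - Y * e01 - Y * e11

theorem two_imp_diag {R : Type*} [CommRing R] (a b c : R)
    (h : ∃ p q : R, Ideal.span {p * a, p * b + q * c} = ⊤) :
    ∃ d : Fin 2 → R, MatEquiv !![a, b; 0, c] (Matrix.diagonal d) := by
  obtain ⟨p, q, h⟩ := h
  obtain ⟨x, y, h⟩ := (span_pair_top_iff _ _).1 h
  -- second row of the product of the two unimodular transformations
  let z := -y * c * a * x + (-y * c * b + (x * a + y * b) * c) * y
  let w := y * c * a * (p * b + q * c) + (-y * c * b + (x * a + y * b) * c) * (p * a)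
  refine ⟨![1, w], !![1, 0; -z, 1] * !![p, q; -y * c, x * a + y * b],
    !![x, -(p * b + q * c); y, p * a], ?_, ?_, ?_⟩
  · rw [Matrix.isUnit_iff_isUnit_det, Matrix.det_mul, Matrix.det_fin_two_of,
      Matrix.det_fin_two_of]
    convert isUnit_one
    linear_combination h
  · rw [Matrix.isUnit_iff_isUnit_det, Matrix.det_fin_two_of]
    convert isUnit_one
    linear_combination h
  · rw [Matrix.mul_assoc, Matrix.mul_assoc]
    have h2 : !![p, q; -y * c, x * a + y * b] *
        (!![a, b; 0, c] * !![x, -(p * b + q * c); y, p * a]) = !![1, 0; z, w] := by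
      ext i j
      fin_cases i <;> fin_cases j <;>
        simp [Matrix.mul_apply, Fin.sum_univ_two, z, w]
      · linear_combination h
      all_goals ring
    rw [h2]
    ext i j
    fin_cases i <;> fin_cases j <;>
        simp [Matrix.mul_apply, Fin.sum_univ_two]

theorem two_imp_strong {R : Type*} [CommRing R] (a b c : R)
    (h : ∃ p q : R, Ideal.span {p * a, p * b + q * c} = ⊤) :
    ∃ lam u v : R, b + lam * c = u * v ∧
        Ideal.span {u, a} = ⊤ ∧ Ideal.span {v, c} = ⊤ ∧
        Ideal.span {u, v} = ⊤ := by
  simp only [span_pair_top_iff] at h ⊢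
  obtain ⟨p, q, x, y, h⟩ := h
  let u := p * b + q * c
  let v := (x + y * x * u) * a + y ^ 2 * u * b
  have key : p * v + y ^ 2 * u * q * c = 1 := by
    simp only [u, v]
    linear_combination (1 + y * (p * b + q * c)) * h
  refine ⟨v * q - y ^ 2 * u * q * b, u, v, ?_, ⟨y, x * p, ?_⟩, ⟨p, y ^ 2 * u * q, key⟩,
    ⟨y ^ 2 * q * c, p, ?_⟩⟩
  · have : u = p * b + q * c := rfl
    linear_combination (-b) * key - v * this
  · simp only [u]
    linear_combination h
  · linear_combination key

theorem two_imp_three {R : Type*} [CommRing R] (a b c : R)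
    (h : ∃ p q : R, Ideal.span {p * a, p * b + q * c} = ⊤) :
    ∃ p q : R, Ideal.span {p * b + q * c, a} = ⊤ ∧ Ideal.span {p, c} = ⊤ := by
  simp only [span_pair_top_iff] at h ⊢
  obtain ⟨p, q, x, y, h⟩ := h
  exact ⟨p, q, ⟨y, x * p, by linear_combination h⟩,
    ⟨x * a + y * b, y * q, by linear_combination h⟩⟩

theorem three_imp_two {R : Type*} [CommRing R] (hKH : IsKHermite R) (a b c : R)
    (h : ∃ p q : R, Ideal.span {p * b + q * c, a} = ⊤ ∧ Ideal.span {p, c} = ⊤) :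
    ∃ p q : R, Ideal.span {p * a, p * b + q * c} = ⊤ := by
  simp only [span_pair_top_iff] at h
  obtain ⟨p, q, ⟨x, y, h1⟩, ⟨z, w, h2⟩⟩ := h
  obtain ⟨d, p, q, s, t, rfl, rfl, h3⟩ := hKH.factor p q
  refine ⟨p, q, ?_⟩
  have i1 : IsCoprime a (p * b + q * c) := ⟨y, x * d, by linear_combination h1⟩
  have i2 : IsCoprime p c := ⟨z * d, w, by linear_combination h2⟩
  have i3 : IsCoprime p q := ⟨s, t, h3⟩
  have i4 : IsCoprime p (p * b + q * c) := by
    obtain ⟨e, f, hef⟩ := i3.mul_right i2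
    exact ⟨e - f * b, f, by linear_combination hef⟩
  rw [span_pair_top_iff]
  exact i4.mul_left i1

theorem three_imp_four {R : Type*} [CommRing R] (a b c : R)
    (h : ∃ p q : R, Ideal.span {p * b + q * c, a} = ⊤ ∧ Ideal.span {p, c} = ⊤) :
    ∃ lam u v : R, b + lam * c = u * v ∧
        Ideal.span {u, a} = ⊤ ∧ Ideal.span {v, c} = ⊤ := by
  obtain ⟨p, q, h1, h2⟩ := h
  rw [span_pair_top_iff] at h2
  obtain ⟨s, t, h2⟩ := h2
  refine ⟨s * q - t * b, p * b + q * c, s, ?_, h1, ?_⟩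
  · linear_combination (-b) * h2
  · rw [span_pair_top_iff]
    exact ⟨p, t, by linear_combination h2⟩

theorem four_imp_three {R : Type*} [CommRing R] (a b c : R)
    (h : ∃ lam u v : R, b + lam * c = u * v ∧
        Ideal.span {u, a} = ⊤ ∧ Ideal.span {v, c} = ⊤) :
    ∃ p q : R, Ideal.span {p * b + q * c, a} = ⊤ ∧ Ideal.span {p, c} = ⊤ := by
  obtain ⟨l, u, v, h, h1, h2⟩ := h
  rw [span_pair_top_iff] at h2
  obtain ⟨s, t, h2⟩ := h2
  have : s * b + (s * l + u * t) * c = u := by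
    linear_combination s * h + u * h2
  refine ⟨s, s * l + u * t, ?_, ?_⟩
  · rw [this]; exact h1
  · rw [span_pair_top_iff]
    exact ⟨v, t, by linear_combination h2⟩

/-- Variants of the Kaplansky condition in a K-Hermite ring: the four
conditions are equivalent, and in (4) one may moreover take `(u, v) = (1)`. -/
theorem kaplansky_condition_variants
    {R : Type*} [CommRing R] (hKH : IsKHermite R) (a b c : R)
    (habc : Ideal.span {a, b, c} = ⊤) :
    ((∃ d : Fin 2 → R, MatEquiv !![a, b; 0, c] (Matrix.diagonal d)) ↔
      (∃ p q : R, Ideal.span {p * a, p * b + q * c} = ⊤)) ∧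
    ((∃ p q : R, Ideal.span {p * a, p * b + q * c} = ⊤) ↔
      (∃ p q : R, Ideal.span {p * b + q * c, a} = ⊤ ∧ Ideal.span {p, c} = ⊤)) ∧
    ((∃ p q : R, Ideal.span {p * b + q * c, a} = ⊤ ∧ Ideal.span {p, c} = ⊤) ↔
      (∃ lam u v : R, b + lam * c = u * v ∧
        Ideal.span {u, a} = ⊤ ∧ Ideal.span {v, c} = ⊤)) ∧
    ((∃ d : Fin 2 → R, MatEquiv !![a, b; 0, c] (Matrix.diagonal d)) →
      (∃ lam u v : R, b + lam * c = u * v ∧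
        Ideal.span {u, a} = ⊤ ∧ Ideal.span {v, c} = ⊤ ∧
        Ideal.span {u, v} = ⊤)) := by
  exact ⟨⟨diag_imp_two a b c habc, two_imp_diag a b c⟩,
    ⟨two_imp_three a b c, three_imp_two hKH a b c⟩,
    ⟨three_imp_four a b c, four_imp_three a b c⟩,
    fun h => two_imp_strong a b c (diag_imp_two a b c habc h)⟩
end

section
/- Let R be a Bézout domain and let a, b, c ∈ R with (a, b, c) = (1). Then the following are equivalent: (i) there exist λ, u, v ∈ R with b + λ·c = u·v, (u, a) = (1), and (v, c) = (1); (ii) there exist elements λ, a₁, c₁ ∈ R such that b + λ·c divides (1 − a₁·a)·(1 − c₁·c) in R. -/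
/-- In a Bézout domain, the factorization condition (4) is equivalent to the
divisibility condition (*). -/
theorem bezout_factorization_iff_divides
    {R : Type*} [CommRing R] [IsDomain R] [IsBezout R] (a b c : R)
    (habc : Ideal.span {a, b, c} = ⊤) :
    (∃ lam u v : R, b + lam * c = u * v ∧
        Ideal.span {u, a} = ⊤ ∧ Ideal.span {v, c} = ⊤) ↔
      (∃ lam a₁ c₁ : R, (b + lam * c) ∣ (1 - a₁ * a) * (1 - c₁ * c)) := by
  simp only [Ideal.eq_top_iff_one, Ideal.mem_span_pair]
  constructor
  · rintro ⟨lam, u, v, h, ⟨s, t, h1⟩, ⟨s', t', h2⟩⟩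
    refine ⟨lam, t, t', s * s', ?_⟩
    have e1 : 1 - t * a = s * u := by linear_combination -h1
    have e2 : 1 - t' * c = s' * v := by linear_combination -h2
    rw [h, e1, e2]
    ring
  · rintro ⟨lam, a₁, c₁, h⟩
    classical
    let _ : GCDMonoid R := IsBezout.toGCDDomain R
    obtain ⟨u, v, ⟨p, hu⟩, ⟨q, hv⟩, h3⟩ := exists_dvd_and_dvd_of_dvd_mul h
    exact ⟨lam, u, v, h3, ⟨p, a₁, by linear_combination -hu⟩,
      ⟨q, c₁, by linear_combination -hv⟩⟩
end

section
/- Let R be a K-Hermite commutative ring. Then R is an elementary divisor ring if and only if for any elements x, y, z ∈ R with (x, y) = (1) there exist elements λ, u, v ∈ R such that x + λ·y = u·v, (u, z) = (1), and (v, 1 − z) = (1). Moreover, the elements u and v can be chosen so that additionally (u, v) = (1). -/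
/-- A commutative ring is an elementary divisor ring: every rectangular matrix
is equivalent to a diagonal matrix (all off-diagonal entries zero). -/
def IsEDR (R : Type*) [CommRing R] : Prop :=
  ∀ (m n : ℕ) (A : Matrix (Fin m) (Fin n) R),
    ∃ (P : Matrix (Fin m) (Fin m) R) (Q : Matrix (Fin n) (Fin n) R),
      IsUnit P ∧ IsUnit Q ∧
      ∀ (i : Fin m) (j : Fin n), (i : ℕ) ≠ (j : ℕ) → (P * A * Q) i j = 0

namespace EDRProof

open Matrix

variable {R : Type*} [CommRing R]

lemma span_pair_top {x y : R} : Ideal.span {x, y} = ⊤ ↔ ∃ a b : R, a * x + b * y = 1 := by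
  rw [Ideal.eq_top_iff_one, Ideal.mem_span_pair]

/-- The usual form of the Hermite condition. -/
def Herm (R : Type*) [CommRing R] : Prop :=
  ∀ a b : R, ∃ d a' b' s t : R, a = d * a' ∧ b = d * b' ∧ s * a' + t * b' = 1

lemma herm_of_kHermite (h : IsKHermite R) : Herm R := by
  intro a b
  obtain ⟨d, a₁, b₁, h1, hd, hs⟩ := h a b
  obtain ⟨s, t, hst⟩ := span_pair_top.1 h1
  have : -t * a + s * b ∈ Ideal.span {d} := by
    rw [hs, Ideal.mem_span_pair]; exact ⟨-t, s, rfl⟩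
  obtain ⟨c, hc⟩ := Ideal.mem_span_singleton'.1 this
  refine ⟨d, s - c * b₁, t + c * a₁, a₁, b₁, ?_, ?_, ?_⟩
  · linear_combination (-a) * hst - s * hd + b₁ * hc
  · linear_combination (-b) * hst - t * hd - a₁ * hc
  · linear_combination hst

/-- Stable range two. -/
lemma sr2 (h : Herm R) {X Y Z f1 f2 D : R} (h1 : X * f1 + Y * f2 + Z * D = 1) :
    ∃ k1 k2 e f : R, e * (f1 + k1 * D) + f * (f2 + k2 * D) = 1 := by
  obtain ⟨d, g1, g2, s, t, rfl, rfl, hst⟩ := h f1 f2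
  refine ⟨-t, s, (X * g1 + Y * g2) * s - Z * g2, (X * g1 + Y * g2) * t + Z * g1, ?_⟩
  linear_combination h1 + ((X * g1 + Y * g2) * d + Z * D) * hst

def Cond (R : Type*) [CommRing R] : Prop :=
  ∀ x y z : R, Ideal.span {x, y} = ⊤ →
        ∃ lam u v : R, x + lam * y = u * v ∧
          Ideal.span {u, z} = ⊤ ∧ Ideal.span {v, 1 - z} = ⊤

lemma criterion (h : Herm R) (hc : Cond R) {α β γ a b c : R}
    (h1 : α * a + β * b + γ * c = 1) :
    ∃ p q e f : R, e * (p * a + q * b) + f * (q * c) = 1 := by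
  obtain ⟨δ, y, x, s, t, rfl, rfl, hst⟩ := h a b
  obtain ⟨z, hz⟩ : ∃ z, z = (α * y + β * x) * δ := ⟨_, rfl⟩
  have hz' : 1 - z = γ * c := by linear_combination -h1 - hz
  obtain ⟨lam, u, v, huv, hu, hv⟩ := hc x y z
    (span_pair_top.2 ⟨t, s, by linear_combination hst⟩)
  obtain ⟨u1, z1, hu⟩ := span_pair_top.1 hu
  obtain ⟨v1, w1, hv⟩ := span_pair_top.1 hv
  obtain ⟨q, hq⟩ : ∃ q, q = u1 + z * z1 * t * v := ⟨_, rfl⟩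
  obtain ⟨w, hw⟩ : ∃ w, w = z1 * (s - t * lam) := ⟨_, rfl⟩
  have huq : u * q + y * z * w = 1 := by
    rw [hq, hw]
    linear_combination hu - z * z1 * t * huv + z * z1 * hst
  have hpq : (q * lam + z * w * v) * y + q * x = v := by
    linear_combination q * huv + v * huq
  obtain ⟨k1, k2, e, f, hef⟩ := sr2 h (X := v1) (Y := (z * w1 + 1) * u) (Z := (z * w1 + 1) * w)
    (f1 := z * v) (f2 := q * (1 - z)) (D := y * z * (1 - z)) (by
      linear_combination z * hv + (z * w1 + 1) * (1 - z) * huq)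
  refine ⟨q * lam + z * w * v + k1 * (1 - z) - k2 * z * x, q + k2 * y * z,
    e * (α * y + β * x), f * γ, ?_⟩
  generalize q * lam + z * w * v = p at *
  have e1 : (p + k1 * (1 - z) - k2 * z * x) * (δ * y) + (q + k2 * y * z) * (δ * x)
      = δ * (v + k1 * y * (1 - z)) := by
    rw [← hpq]; ring
  rw [e1]
  have e2 : e * (α * y + β * x) * (δ * (v + k1 * y * (1 - z))) = e * (z * v + k1 * (y * z * (1 - z))) := by
    linear_combination (-e * (v + k1 * y * (1 - z))) * hz
  have e3 : f * γ * ((q + k2 * y * z) * c) = f * (q * (1 - z) + k2 * (y * z * (1 - z))) := by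
    linear_combination (-f * (q + k2 * y * z)) * hz'
  rw [e2, e3, hef]

lemma forward (h : IsEDR R) (x y z : R) (hxy : Ideal.span {x, y} = ⊤) :
    ∃ lam u v : R, x + lam * y = u * v ∧
          Ideal.span {u, z} = ⊤ ∧ Ideal.span {v, 1 - z} = ⊤ ∧
          Ideal.span {u, v} = ⊤ := by
  obtain ⟨t, s, hst⟩ := span_pair_top.1 hxy
  -- the matrix
  obtain ⟨P, Q, hP, hQ, hD⟩ := h 2 2 !![y * z, 0; z * x, 1 - z]
  obtain ⟨P', hP1, hP2⟩ := isUnit_iff_exists.1 hP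
  obtain ⟨Q', hQ1, hQ2⟩ := isUnit_iff_exists.1 hQ
  obtain ⟨M, hM⟩ : ∃ M : Matrix (Fin 2) (Fin 2) R, M = !![y * z, 0; z * x, 1 - z] := ⟨_, rfl⟩
  rw [← hM] at hD
  obtain ⟨D, hDD⟩ : ∃ D, D = P * M * Q := ⟨_, rfl⟩
  have hM2 : M = P' * D * Q' := by
    rw [hDD]
    calc M = (P' * P) * M * (Q * Q') := by rw [hP2, hQ1, Matrix.one_mul, Matrix.mul_one]
      _ = _ := by simp only [Matrix.mul_assoc]
  rw [← hDD] at hD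
  have h01 : D 0 1 = 0 := hD 0 1 (by simp)
  have h10 : D 1 0 = 0 := hD 1 0 (by simp)
  have hent : ∀ i j, M i j = (P' i 0 * Q' 0 j) * D 0 0 + (P' i 1 * Q' 1 j) * D 1 1 := by
    intro i j
    rw [hM2]
    simp [Matrix.mul_apply, Fin.sum_univ_two, h01, h10]
    ring
  have m00 := hent 0 0
  have m10 := hent 1 0
  have m11 := hent 1 1
  simp only [hM, Matrix.of_apply, Matrix.cons_val', Matrix.cons_val_zero, Matrix.cons_val_one,
    Matrix.cons_val_fin_one] at m00 m10 m11
  obtain ⟨A, B, hAB⟩ : ∃ A B, A * D 0 0 + B * D 1 1 = 1 := by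
    refine ⟨s * (P' 0 0 * Q' 0 0) + t * (P' 1 0 * Q' 0 0) + P' 1 0 * Q' 0 1,
      s * (P' 0 1 * Q' 1 0) + t * (P' 1 1 * Q' 1 0) + P' 1 1 * Q' 1 1, ?_⟩
    linear_combination z * hst - s * m00 - t * m10 - m11
  have d0 : D 0 0 = (P 0 0 * (y * z) + P 0 1 * (z * x)) * Q 0 0 + P 0 1 * (1 - z) * Q 1 0 := by
    rw [hDD, hM]; simp [Matrix.mul_apply, Fin.sum_univ_two]
  have d01 : 0 = (P 0 0 * (y * z) + P 0 1 * (z * x)) * Q 0 1 + P 0 1 * (1 - z) * Q 1 1 := by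
    rw [← h01, hDD, hM]; simp [Matrix.mul_apply, Fin.sum_univ_two]
  have d10 : 0 = (P 1 0 * (y * z) + P 1 1 * (z * x)) * Q 0 0 + P 1 1 * (1 - z) * Q 1 0 := by
    rw [← h10, hDD, hM]; simp [Matrix.mul_apply, Fin.sum_univ_two]
  have d1 : D 1 1 = (P 1 0 * (y * z) + P 1 1 * (z * x)) * Q 0 1 + P 1 1 * (1 - z) * Q 1 1 := by
    rw [hDD, hM]; simp [Matrix.mul_apply, Fin.sum_univ_two]
  obtain ⟨p, q, e, f, hpq⟩ : ∃ p q e f : R,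
      e * (z * (p * y + q * x)) + f * (q * (1 - z)) = 1 := by
    refine ⟨P 0 0 + P 1 0, P 0 1 + P 1 1, A * Q 0 0 + B * Q 0 1, A * Q 1 0 + B * Q 1 1, ?_⟩
    linear_combination hAB - A * d0 - B * d1 - B * d01 - A * d10
  clear hAB d0 d01 d10 d1 m00 m10 m11 hent h01 h10 hD hDD hM2 hM
  obtain ⟨v, hv⟩ : ∃ v, v = p * y + q * x := ⟨_, rfl⟩
  rw [← hv] at hpq
  -- `q` is coprime to `z`, `v`, `y`
  have cz : IsCoprime q z := ⟨f * (1 - z), e * v, by linear_combination hpq⟩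
  have cv : IsCoprime q v := ⟨f * (1 - z), e * z, by linear_combination hpq⟩
  have cy : IsCoprime q y := ⟨f * (1 - z) + e * z * x, e * z * p, by
    linear_combination hpq - e * z * hv⟩
  obtain ⟨u, w, huw⟩ := (cy.mul_right cz).mul_right cv
  -- u * q + w * (y * z * v) = 1
  refine ⟨u * p - w * z * v * x, u, v, ?_, ?_, ?_, ?_⟩
  · linear_combination -u * hv - x * huw
  · exact span_pair_top.2 ⟨q, w * y * v, by linear_combination huw⟩
  · exact span_pair_top.2 ⟨e * z, f * q, by linear_combination hpq⟩
  · exact span_pair_top.2 ⟨q, w * y * z, by linear_combination huw⟩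

/-! ### Unimodular vectors -/

lemma factor (h : Herm R) : ∀ (n : ℕ) (f : Fin (n + 1) → R),
    ∃ (d : R) (f' g : Fin (n + 1) → R), f = d • f' ∧ g ⬝ᵥ f' = 1 := by
  intro n
  induction n with
  | zero =>
    intro f
    refine ⟨f 0, fun _ => 1, fun _ => 1, ?_, ?_⟩
    · ext i; fin_cases i; simp
    · simp [dotProduct]
  | succ n ih =>
    intro f
    obtain ⟨d, f', g, hf, hg⟩ := ih (fun i => f i.succ)
    obtain ⟨e, x, y, s, t, hx, hy, hst⟩ := h (f 0) d
    refine ⟨e, Fin.cons x (y • f'), Fin.cons s (t • g), ?_, ?_⟩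
    · ext i
      refine Fin.cases ?_ (fun j => ?_) i
      · simpa using hx
      · have := congrFun hf j
        simp only [Pi.smul_apply, smul_eq_mul] at this
        simp [this, hy, mul_assoc]
    · rw [dotProduct, Fin.sum_univ_succ]
      simp only [Fin.cons_zero, Fin.cons_succ]
      have : ∑ i, (t • g) i * (y • f') i = t * y * (g ⬝ᵥ f') := by
        rw [dotProduct, Finset.mul_sum]
        refine Finset.sum_congr rfl fun i _ => ?_
        simp only [Pi.smul_apply, smul_eq_mul]; ring
      rw [this, hg]; linear_combination hst

def blk {m n : ℕ} (c : R) (A : Matrix (Fin m) (Fin n) R) : Matrix (Fin (m + 1)) (Fin (n + 1)) R :=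
  Matrix.of (Fin.cons (Fin.cons c 0) (fun i => Fin.cons 0 (A i)))

@[simp] lemma blk_zz {m n : ℕ} (c : R) (A : Matrix (Fin m) (Fin n) R) : blk c A 0 0 = c := rfl
@[simp] lemma blk_zs {m n : ℕ} (c : R) (A : Matrix (Fin m) (Fin n) R) (j : Fin n) :
    blk c A 0 j.succ = 0 := rfl
@[simp] lemma blk_sz {m n : ℕ} (c : R) (A : Matrix (Fin m) (Fin n) R) (i : Fin m) :
    blk c A i.succ 0 = 0 := rfl
@[simp] lemma blk_ss {m n : ℕ} (c : R) (A : Matrix (Fin m) (Fin n) R) (i : Fin m) (j : Fin n) :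
    blk c A i.succ j.succ = A i j := rfl

lemma ext_succ {S : Type*} {m n : ℕ} {A B : Matrix (Fin (m + 1)) (Fin (n + 1)) S}
    (h1 : A 0 0 = B 0 0) (h2 : ∀ j : Fin n, A 0 j.succ = B 0 j.succ)
    (h3 : ∀ i : Fin m, A i.succ 0 = B i.succ 0)
    (h4 : ∀ (i : Fin m) (j : Fin n), A i.succ j.succ = B i.succ j.succ) : A = B := by
  ext i j
  refine Fin.cases ?_ (fun i => ?_) i <;> refine Fin.cases ?_ (fun j => ?_) j
  exacts [h1, h2 j, h3 i, h4 i j]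

lemma blk_mul {l m n : ℕ} (a b : R) (A : Matrix (Fin l) (Fin m) R) (B : Matrix (Fin m) (Fin n) R) :
    blk a A * blk b B = blk (a * b) (A * B) := by
  apply ext_succ <;> intros <;> simp [Matrix.mul_apply, Fin.sum_univ_succ]

lemma blk_one {n : ℕ} : blk (1 : R) (1 : Matrix (Fin n) (Fin n) R) = 1 := by
  apply ext_succ <;> intros <;>
    simp [Matrix.one_apply, Fin.succ_ne_zero, (Fin.succ_ne_zero _).symm]

lemma blk_unit {n : ℕ} {P : Matrix (Fin n) (Fin n) R} (h : IsUnit P) : IsUnit (blk 1 P) := by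
  obtain ⟨P', h1, h2⟩ := isUnit_iff_exists.1 h
  exact isUnit_iff_exists.2 ⟨blk 1 P', by rw [blk_mul, h1, mul_one, blk_one],
    by rw [blk_mul, h2, mul_one, blk_one]⟩

/-- A two by two block followed by the identity. -/
def two {n : ℕ} (x y z w : R) : Matrix (Fin (n + 2)) (Fin (n + 2)) R :=
  Matrix.of (Fin.cons (Fin.cons x (Fin.cons y 0)) (Fin.cons (Fin.cons z (Fin.cons w 0))
    (fun i => Fin.cons 0 (Fin.cons 0 ((1 : Matrix (Fin n) (Fin n) R) i)))))

lemma two_mul_two {n : ℕ} (x y z w x' y' z' w' : R) :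
    two (n := n) x y z w * two x' y' z' w' =
      two (x * x' + y * z') (x * y' + y * w') (z * x' + w * z') (z * y' + w * w') := by
  ext i j
  refine Fin.cases ?_ (fun i => Fin.cases ?_ (fun i => ?_) i) i <;>
  refine Fin.cases ?_ (fun j => Fin.cases ?_ (fun j => ?_) j) j <;>
  simp [two, Matrix.mul_apply, Fin.sum_univ_succ, Matrix.one_apply]

lemma two_one {n : ℕ} : two (n := n) (1 : R) 0 0 1 = 1 := by
  ext i j
  refine Fin.cases ?_ (fun i => Fin.cases ?_ (fun i => ?_) i) i <;>
  refine Fin.cases ?_ (fun j => Fin.cases ?_ (fun j => ?_) j) j <;>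
  simp [two, Matrix.one_apply, Fin.ext_iff]

lemma complete (h : Herm R) : ∀ (n : ℕ) (p g : Fin (n + 1) → R), g ⬝ᵥ p = 1 →
    ∃ P : Matrix (Fin (n + 1)) (Fin (n + 1)) R, IsUnit P ∧ P 0 = p := by
  intro n
  induction n with
  | zero =>
    intro p g hg
    refine ⟨Matrix.of fun _ _ => p 0, ?_, ?_⟩
    · rw [Matrix.isUnit_iff_isUnit_det, Matrix.det_fin_one]
      refine IsUnit.of_mul_eq_one (g 0) ?_
      simpa [dotProduct, mul_comm] using hg
    · ext i; fin_cases i; rfl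
  | succ n ih =>
    intro p g hg
    obtain ⟨d, f', g', hf, hg'⟩ := factor h n (fun i => p i.succ)
    obtain ⟨P, hP, hP0⟩ := ih f' g' hg'
    have hf2 : ∀ i, p (Fin.succ i) = d * f' i := fun i => congrFun hf i
    have hs : g 0 * p 0 + (∑ i : Fin (n + 1), g i.succ * f' i) * d = 1 := by
      rw [← hg, dotProduct, Finset.sum_mul, Fin.sum_univ_succ (fun i => g i * p i)]
      congr 1
      refine Finset.sum_congr rfl fun i _ => ?_
      rw [hf2]; ring
    generalize (∑ i : Fin (n + 1), g i.succ * f' i) = t at hs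
    refine ⟨two (p 0) d (-t) (g 0) * blk 1 P, IsUnit.mul ?_ (blk_unit hP), ?_⟩
    · have e : (p 0) * g 0 + d * t = 1 := by linear_combination hs
      have e' : t * d + g 0 * p 0 = 1 := by linear_combination hs
      refine isUnit_iff_exists.2 ⟨two (g 0) (-d) t (p 0), ?_, ?_⟩
      · rw [two_mul_two, ← two_one]
        congr 1
        · ring
        · ring
        · linear_combination hs
      · rw [two_mul_two, ← two_one]
        congr 1
        · linear_combination hs
        · ring
        · ring
        · linear_combination hs
    · ext j
      refine Fin.cases ?_ (fun j => ?_) j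
      · simp [Matrix.mul_apply, Fin.sum_univ_succ, two]
      · rw [Matrix.mul_apply, Fin.sum_univ_succ, Fin.sum_univ_succ]
        simp only [blk_zs, blk_ss, hP0, hf2]
        simp [two]

/-! ### Spans of vectors -/

abbrev vs {n : ℕ} (v : Fin n → R) : Ideal R := Ideal.span (Set.range v)

lemma mem_vs {n : ℕ} (v : Fin n → R) (i : Fin n) : v i ∈ vs v := Ideal.subset_span ⟨i, rfl⟩

lemma vecMul_mem {m n : ℕ} (I : Ideal R) (v : Fin m → R) (hv : ∀ i, v i ∈ I)
    (P : Matrix (Fin m) (Fin n) R) (j : Fin n) : (v ᵥ* P) j ∈ I := by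
  rw [Matrix.vecMul, dotProduct]
  exact Ideal.sum_mem _ fun i _ => I.mul_mem_right _ (hv i)

lemma scaled (h : Herm R) (hc : Cond R) (a b c : R) :
    ∃ p q : R, ∀ I : Ideal R, p * a + q * b ∈ I → q * c ∈ I → a ∈ I ∧ b ∈ I ∧ c ∈ I := by
  obtain ⟨d, f', g, hf, hg⟩ := factor h 2 ![a, b, c]
  have ha : a = d * f' 0 := congrFun hf 0
  have hb : b = d * f' 1 := congrFun hf 1
  have hcc : c = d * f' 2 := congrFun hf 2
  have hg : g 0 * f' 0 + g 1 * f' 1 + g 2 * f' 2 = 1 := by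
    rw [← hg]; exact (Fin.sum_univ_three (fun i => g i * f' i)).symm
  obtain ⟨p, q, e, f, hef⟩ := criterion h hc hg
  refine ⟨p, q, fun I h1 h2 => ?_⟩
  have hd : d ∈ I := by
    have : d = e * (p * a + q * b) + f * (q * c) := by
      rw [ha, hb, hcc]; linear_combination (-d) * hef
    rw [this]
    exact I.add_mem (I.mul_mem_left _ h1) (I.mul_mem_left _ h2)
  rw [ha, hb, hcc]
  exact ⟨I.mul_mem_right _ hd, I.mul_mem_right _ hd, I.mul_mem_right _ hd⟩

lemma principal (h : Herm R) : ∀ (n : ℕ) (f : Fin n → R), ∃ (c : R) (g : Fin n → R),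
    c = g ⬝ᵥ f ∧ ∀ i, c ∣ f i := by
  intro n f
  cases n with
  | zero => exact ⟨0, 0, by simp, fun i => i.elim0⟩
  | succ n =>
    obtain ⟨d, f', g, hf, hg⟩ := factor h n f
    refine ⟨d, g, ?_, fun i => ⟨f' i, congrFun hf i⟩⟩
    rw [hf, dotProduct_smul, hg]; simp

lemma tworow (h : Herm R) (hc : Cond R) (n : ℕ) (r w : Fin n → R) :
    ∃ s t : R, ∀ i, r i ∈ vs (s • r + t • w) ∧ w i ∈ vs (s • r + t • w) := by
  cases n with
  | zero => exact ⟨0, 0, fun i => i.elim0⟩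
  | succ n =>
    obtain ⟨a, r', g, hr, hg⟩ := factor h n r
    obtain ⟨P, hP, hP0⟩ := complete h n r' g hg
    obtain ⟨P', h1, h2⟩ := isUnit_iff_exists.1 hP
    obtain ⟨k, hk⟩ : ∃ k, k = w ᵥ* P' := ⟨_, rfl⟩
    have hw : w = k ᵥ* P := by rw [hk, Matrix.vecMul_vecMul, h2, Matrix.vecMul_one]
    obtain ⟨c, l, hcl, hcd⟩ := principal h n (fun j => k j.succ)
    obtain ⟨p, q, hpq⟩ := scaled h hc a (k 0) c
    have hr2 : r = (a • Pi.single 0 1 : Fin (n + 1) → R) ᵥ* P := by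
      rw [Matrix.smul_vecMul, Matrix.single_one_vecMul, hr, ← hP0]; rfl
    obtain ⟨v, hv⟩ : ∃ v, v = p • r + q • w := ⟨_, rfl⟩
    obtain ⟨x, hx⟩ : ∃ x : Fin (n + 1) → R, x = v ᵥ* P' := ⟨_, rfl⟩
    have hx2 : x = p • (a • Pi.single 0 1 : Fin (n + 1) → R) + q • k := by
      rw [hx, hv, hr2, hw, Matrix.add_vecMul, Matrix.smul_vecMul p, Matrix.smul_vecMul q,
        Matrix.vecMul_vecMul, Matrix.vecMul_vecMul, h1, Matrix.vecMul_one, Matrix.vecMul_one]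
    have hxm : ∀ j, x j ∈ vs v := fun j => by
      rw [hx]; exact vecMul_mem _ _ (mem_vs v) _ _
    obtain ⟨ha, hb, hcm⟩ := hpq (vs v) (by
        have := hxm 0
        rw [hx2] at this; simpa using this) (by
        rw [hcl, dotProduct, Finset.mul_sum]
        refine Ideal.sum_mem _ fun j _ => ?_
        have := hxm j.succ
        rw [hx2] at this
        have h3 : q * k j.succ ∈ vs v := by simpa using this
        have := Ideal.mul_mem_left _ (l j) h3
        convert this using 1; ring)
    refine ⟨p, q, fun i => ?_⟩
    rw [← hv]
    constructor
    · rw [hr]; exact Ideal.mul_mem_right _ _ ha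
    · rw [hw]
      refine vecMul_mem _ _ (fun j => ?_) _ _
      refine Fin.cases hb (fun j => ?_) j
      obtain ⟨e, he⟩ := hcd j
      rw [he]; exact Ideal.mul_mem_right _ _ hcm

lemma rows (h : Herm R) (hc : Cond R) (n : ℕ) : ∀ (m : ℕ) (A : Matrix (Fin m) (Fin n) R),
    ∃ p : Fin m → R, ∀ i j, A i j ∈ vs (p ᵥ* A) := by
  intro m
  induction m with
  | zero => exact fun A => ⟨0, fun i => i.elim0⟩
  | succ m ih =>
    intro A
    obtain ⟨p, hp⟩ := ih (fun i => A i.succ)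
    obtain ⟨s, t, hst⟩ := tworow h hc n (A 0) (p ᵥ* (fun i => A i.succ : Matrix (Fin m) (Fin n) R))
    refine ⟨Fin.cons s (t • p), ?_⟩
    have e : (Fin.cons s (t • p) : Fin (m + 1) → R) ᵥ* A =
        s • A 0 + t • (p ᵥ* (fun i => A i.succ : Matrix (Fin m) (Fin n) R)) := by
      ext j
      simp [Matrix.vecMul, dotProduct, Fin.sum_univ_succ, Finset.mul_sum, mul_assoc]
    rw [e]
    intro i j
    refine Fin.cases (hst j).1 (fun i => ?_) i
    refine (Ideal.span_le.2 ?_) (hp i j)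
    rintro _ ⟨j, rfl⟩
    exact (hst j).2

def low {m : ℕ} (x : Fin m → R) : Matrix (Fin (m + 1)) (Fin (m + 1)) R :=
  Matrix.of (Fin.cons (Fin.cons 1 0) (fun i => Fin.cons (x i) ((1 : Matrix (Fin m) (Fin m) R) i)))

@[simp] lemma low_zz {m : ℕ} (x : Fin m → R) : low x 0 0 = 1 := rfl
@[simp] lemma low_zs {m : ℕ} (x : Fin m → R) (j : Fin m) : low x 0 j.succ = 0 := rfl
@[simp] lemma low_sz {m : ℕ} (x : Fin m → R) (i : Fin m) : low x i.succ 0 = x i := rfl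
@[simp] lemma low_ss {m : ℕ} (x : Fin m → R) (i j : Fin m) :
    low x i.succ j.succ = (1 : Matrix (Fin m) (Fin m) R) i j := rfl

lemma low_mul {m : ℕ} (x : Fin m → R) : low x * low (-x) = 1 := by
  rw [← blk_one]
  apply ext_succ <;> intros <;> simp [Matrix.mul_apply, Fin.sum_univ_succ, Matrix.one_apply]

lemma low_unit {m : ℕ} (x : Fin m → R) : IsUnit (low x) :=
  isUnit_iff_exists.2 ⟨low (-x), low_mul x, by simpa using low_mul (-x)⟩

lemma clear_mat {m n : ℕ} (B : Matrix (Fin (m + 1)) (Fin (n + 1)) R) (hB : B 0 0 = 1) :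
    low (fun i => -B i.succ 0) * B * (low (fun j => -B 0 j.succ))ᵀ =
      blk 1 (Matrix.of fun i j => B i.succ j.succ - B i.succ 0 * B 0 j.succ) := by
  apply ext_succ <;> intros <;>
    simp [Matrix.mul_apply, Fin.sum_univ_succ, Matrix.one_apply, hB]
  ring

lemma isUnit_tr {n : ℕ} {P : Matrix (Fin n) (Fin n) R} (h : IsUnit P) : IsUnit Pᵀ := by
  rw [Matrix.isUnit_iff_isUnit_det] at h ⊢
  rwa [Matrix.det_transpose]

lemma factor_mat (h : Herm R) (m n : ℕ) (A : Matrix (Fin (m + 1)) (Fin (n + 1)) R) :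
    ∃ (d : R) (A' : Matrix (Fin (m + 1)) (Fin (n + 1)) R), A = d • A' ∧
      ∀ I : Ideal R, (∀ i j, A' i j ∈ I) → (1 : R) ∈ I := by
  have key : ∀ (N : ℕ) (e : Fin (m + 1) × Fin (n + 1) ≃ Fin (N + 1)),
      ∃ (d : R) (A' : Matrix (Fin (m + 1)) (Fin (n + 1)) R), A = d • A' ∧
      ∀ I : Ideal R, (∀ i j, A' i j ∈ I) → (1 : R) ∈ I := by
    intro N e
    obtain ⟨d, f', g, hf, hg⟩ := factor h N (fun k => A (e.symm k).1 (e.symm k).2)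
    refine ⟨d, fun i j => f' (e (i, j)), ?_, ?_⟩
    · ext i j
      have := congrFun hf (e (i, j))
      simp only [Equiv.symm_apply_apply] at this
      exact this
    · intro I hI
      rw [← hg, dotProduct]
      refine Ideal.sum_mem _ fun k _ => I.mul_mem_left _ ?_
      have := hI (e.symm k).1 (e.symm k).2
      simpa using this
  exact key ((m + 1) * n + m) (finProdFinEquiv.trans (finCongr (by ring)))

lemma backward (h : Herm R) (hc : Cond R) : IsEDR R := by
  intro m
  induction m with
  | zero => exact fun n A => ⟨1, 1, isUnit_one, isUnit_one, fun i => i.elim0⟩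
  | succ m ih =>
    intro n A
    cases n with
    | zero => exact ⟨1, 1, isUnit_one, isUnit_one, fun i j => j.elim0⟩
    | succ n =>
      obtain ⟨d, A', hA, hI⟩ := factor_mat h m n A
      obtain ⟨p, hp⟩ := rows h hc _ _ A'
      have h1 := hI _ hp
      obtain ⟨q, hq⟩ := (Ideal.mem_span_range_iff_exists_fun).1 h1
      have hq' : q ⬝ᵥ (p ᵥ* A') = 1 := hq
      obtain ⟨P, hP, hP0⟩ := complete h m p (A' *ᵥ q) (by
        rw [dotProduct_comm, Matrix.dotProduct_mulVec, dotProduct_comm, hq'])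
      obtain ⟨Q, hQ, hQ0⟩ := complete h n q (p ᵥ* A') (by rw [dotProduct_comm, hq'])
      obtain ⟨B, hB⟩ : ∃ B, B = P * A' * Qᵀ := ⟨_, rfl⟩
      have hB0 : B 0 0 = 1 := by
        rw [hB, ← hq', ← hP0, ← hQ0, dotProduct_comm]
        rfl
      have hcl := clear_mat B hB0
      generalize (Matrix.of fun i j => B (Fin.succ i) (Fin.succ j) - B i.succ 0 * B 0 j.succ) = C
        at hcl
      obtain ⟨P2, Q2, hP2, hQ2, hd⟩ := ih n (d • C)
      refine ⟨blk 1 P2 * (low (fun i => -B i.succ 0) * P),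
        Qᵀ * (low (fun j => -B 0 j.succ))ᵀ * blk 1 Q2,
        (blk_unit hP2).mul ((low_unit _).mul hP),
        ((isUnit_tr hQ).mul (isUnit_tr (low_unit _))).mul (blk_unit hQ2), ?_⟩
      have hfin : blk 1 P2 * (low (fun i => -B i.succ 0) * P) * A *
          (Qᵀ * (low (fun j => -B 0 j.succ))ᵀ * blk 1 Q2) = blk d (P2 * (d • C) * Q2) := by
        have e1 : blk 1 P2 * (low (fun i => -B i.succ 0) * P) * A *
          (Qᵀ * (low (fun j => -B 0 j.succ))ᵀ * blk 1 Q2) =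
          d • (blk 1 P2 * (low (fun i => -B i.succ 0) * (P * A' * Qᵀ) *
            (low (fun j => -B 0 j.succ))ᵀ) * blk 1 Q2) := by
          rw [hA]
          simp only [Matrix.mul_smul, Matrix.smul_mul, Matrix.mul_assoc]
        rw [e1, ← hB, hcl, blk_mul, blk_mul]
        apply ext_succ <;> intros <;> simp
      rw [hfin]
      intro i j
      refine Fin.cases ?_ (fun i => ?_) i <;> refine Fin.cases ?_ (fun j => ?_) j
      · intro h; exact absurd rfl h
      · intro _; rfl
      · intro _; rfl
      · intro h
        exact hd i j (fun h' => h (by simp [h']))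

end EDRProof

/-- A K-Hermite ring is an elementary divisor ring iff for all `x, y, z` with
`(x, y) = (1)` there are `λ, u, v` with `x + λ·y = u·v`, `(u, z) = (1)` and
`(v, 1 - z) = (1)`; moreover `u, v` can be chosen with `(u, v) = (1)`. -/
theorem kHermite_isEDR_iff
    {R : Type*} [CommRing R] (hKH : IsKHermite R) :
    (IsEDR R ↔
      ∀ x y z : R, Ideal.span {x, y} = ⊤ →
        ∃ lam u v : R, x + lam * y = u * v ∧
          Ideal.span {u, z} = ⊤ ∧ Ideal.span {v, 1 - z} = ⊤) ∧
    (IsEDR R →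
      ∀ x y z : R, Ideal.span {x, y} = ⊤ →
        ∃ lam u v : R, x + lam * y = u * v ∧
          Ideal.span {u, z} = ⊤ ∧ Ideal.span {v, 1 - z} = ⊤ ∧
          Ideal.span {u, v} = ⊤) := by
  exact ⟨⟨fun h x y z hxy => by
      obtain ⟨l, u, v, h1, h2, h3, _⟩ := EDRProof.forward h x y z hxy
      exact ⟨l, u, v, h1, h2, h3⟩,
    fun hc => EDRProof.backward (EDRProof.herm_of_kHermite hKH) hc⟩,
    fun h x y z hxy => EDRProof.forward h x y z hxy⟩
end

section
/- Let R be a K-Hermite commutative ring. Then R satisfies Kaplansky's condition (for all a, b, c ∈ R with (a, b, c) = (1) there exist p, q ∈ R with (p·a, p·b + q·c) = (1)) if and only if for any elements x, y, z ∈ R with (x, y) = (1) there exist elements λ, u, v ∈ R such that x + λ·y = u·v, (u, z) = (1), and (v, 1 − z) = (1). -/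
theorem span_pair_top_iff_aux {R : Type*} [CommRing R] (a b : R) :
    Ideal.span {a, b} = ⊤ ↔ IsCoprime a b := by
  rw [Ideal.eq_top_iff_one, Ideal.mem_span_pair]
  rfl

theorem span_triple_top_iff_aux {R : Type*} [CommRing R] (a b c : R) :
    Ideal.span {a, b, c} = ⊤ ↔ ∃ r s t : R, r * a + s * b + t * c = 1 := by
  rw [Ideal.eq_top_iff_one, Ideal.mem_span_insert]
  constructor
  · rintro ⟨r, w, hw, h⟩
    obtain ⟨s, t, rfl⟩ := Ideal.mem_span_pair.1 hw
    exact ⟨r, s, t, by rw [h]; ring⟩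
  · rintro ⟨r, s, t, h⟩
    exact ⟨r, s * b + t * c, Ideal.mem_span_pair.2 ⟨s, t, rfl⟩, by rw [← h]; ring⟩

/-- In a K-Hermite ring any pair is a multiple of a comaximal pair. -/
theorem IsKHermite.gcd_aux {R : Type*} [CommRing R] (h : IsKHermite R) (a b : R) :
    ∃ d m n a₁ b₁ : R, a = d * m ∧ b = d * n ∧ IsCoprime m n ∧ d = a₁ * a + b₁ * b := by
  obtain ⟨d, a₁, b₁, h1, h2, h3⟩ := h a b
  obtain ⟨e, f, hef⟩ := (span_pair_top_iff_aux _ _).1 h1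
  have ha : a ∈ Ideal.span {d} := h3 ▸ Ideal.subset_span (by simp)
  have hb : b ∈ Ideal.span {d} := h3 ▸ Ideal.subset_span (by simp)
  obtain ⟨r, hr⟩ := Ideal.mem_span_singleton.1 ha
  obtain ⟨s, hs⟩ := Ideal.mem_span_singleton.1 hb
  refine ⟨d, e - b₁ * (-f * r + e * s), f + a₁ * (-f * r + e * s), a₁, b₁, ?_, ?_,
    ⟨a₁, b₁, ?_⟩, h2⟩
  · linear_combination (-a) * hef - e * h2 + b₁ * f * hr - b₁ * e * hs
  · linear_combination (-b) * hef - f * h2 - a₁ * f * hr + a₁ * e * hs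
  · linear_combination hef

theorem kaplansky_iff_factorization_condition
    {R : Type*} [CommRing R] (hKH : IsKHermite R) :
    (∀ a b c : R, Ideal.span {a, b, c} = ⊤ →
        ∃ p q : R, Ideal.span {p * a, p * b + q * c} = ⊤) ↔
      (∀ x y z : R, Ideal.span {x, y} = ⊤ →
        ∃ lam u v : R, x + lam * y = u * v ∧
          Ideal.span {u, z} = ⊤ ∧ Ideal.span {v, 1 - z} = ⊤) := by
  simp only [span_pair_top_iff_aux, span_triple_top_iff_aux]
  constructor
  · rintro H x y z ⟨s, t, hst⟩
    obtain ⟨p, q, r, w, h⟩ := H (y * z) x (y * (1 - z)) ⟨t, s, t, by linear_combination hst⟩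
    refine ⟨-x * (w * q * (1 - z)) + q * (1 - z) * (r * (y * z) + w * x),
      p * x + q * (y * (1 - z)), r * (y * z) + w * x, ?_, ⟨w, r * p * y, ?_⟩, ⟨p, w * q * y, ?_⟩⟩
    · linear_combination (-x) * h
    · linear_combination h
    · linear_combination h
  · rintro H a b c ⟨r, s, t, h⟩
    obtain ⟨d, a', c', a₁, c₁, ha, hc, ⟨e, f, hef⟩, hd⟩ := hKH.gcd_aux a c
    have hbd : IsCoprime b d :=
      ⟨s, r * a' + t * c', by linear_combination h - r * ha - t * hc⟩
    obtain ⟨lam, u, v, huv, hu, hv⟩ := H b d (e * a') hbd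
    have h1 : IsCoprime (u * v) d := huv ▸ (IsCoprime.add_mul_right_left hbd lam)
    have hua : IsCoprime u a := by
      rw [ha]
      exact (IsCoprime.of_mul_left_left h1).mul_right (IsCoprime.of_mul_right_right hu)
    have hvc : IsCoprime v c := by
      rw [hc]
      refine (IsCoprime.of_mul_left_right h1).mul_right (IsCoprime.of_mul_right_right (y := f) ?_)
      rwa [show f * c' = 1 - e * a' by linear_combination hef]
    obtain ⟨p, q', hp⟩ := hvc
    obtain ⟨g, p', q, m, n, hgp, hgq, hpq, -⟩ := hKH.gcd_aux p (u * q')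
    have hgu : u = (p' * (u * v) + q * c) * g := by
      linear_combination (-u) * hp + u * v * hgp + c * hgq
    have hwa : IsCoprime (p' * (u * v) + q * c) a :=
      IsCoprime.of_mul_left_left (hgu ▸ hua : IsCoprime ((p' * (u * v) + q * c) * g) a)
    have hpc : IsCoprime p' c := by
      have : IsCoprime p c := ⟨v, q', by linear_combination hp⟩
      rw [hgp] at this
      exact IsCoprime.of_mul_left_right this
    have hpw : IsCoprime p' (p' * (u * v) + q * c) := by
      have := IsCoprime.add_mul_left_right (hpq.mul_right hpc) (u * v)
      rwa [add_comm] at this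
    have hfin : IsCoprime (p' * a) (p' * (u * v) + q * c) := hpw.mul_left hwa.symm
    refine ⟨p', q + p' * lam * c₁, ?_⟩
    have := IsCoprime.add_mul_left_right hfin (-(lam * a₁))
    have he : p' * b + (q + p' * lam * c₁) * c
        = p' * (u * v) + q * c + p' * a * -(lam * a₁) := by
      linear_combination p' * huv - p' * lam * hd
    rwa [he]
end

section
/- Let R be a Bézout domain. Then R is an elementary divisor ring if and only if for any nonzero elements x, y, z ∈ R there exist elements λ, a, b ∈ R such that x + λ·y divides y·(1 − a·z)·(1 − b·(1 − z)) in R. -/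
namespace BezoutEDR

open Matrix

section basic

variable {R : Type*} [CommRing R] [IsDomain R] [IsBezout R]

/-- Extraction of the content of a finite family. -/
lemma content_exists {ι : Type*} [Fintype ι] [Nonempty ι] (v : ι → R) :
    ∃ (d : R) (w c : ι → R), v = d • w ∧ w ⬝ᵥ c = 1 := by
  classical
  have hp : (Ideal.span (Set.range v)).IsPrincipal :=
    IsBezout.isPrincipal_of_FG _ (by
      refine ⟨Finset.univ.image v, ?_⟩
      simp [Ideal.span])
  obtain ⟨d, hd⟩ := hp
  have hd' : Ideal.span (Set.range v) = Ideal.span {d} := hd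
  have h1 : ∀ i, ∃ w, v i = d * w := by
    intro i
    have : v i ∈ Ideal.span {d} := hd' ▸ Ideal.subset_span ⟨i, rfl⟩
    obtain ⟨w, hw⟩ := Ideal.mem_span_singleton'.1 this
    exact ⟨w, by rw [← hw, mul_comm]⟩
  have h2 : d ∈ Ideal.span (Set.range v) := hd' ▸ Ideal.mem_span_singleton_self d
  obtain ⟨c, hc⟩ := (Ideal.mem_span_range_iff_exists_fun).1 h2
  choose w hw using h1
  by_cases h0 : d = 0
  · obtain ⟨i⟩ := ‹Nonempty ι›
    refine ⟨0, Pi.single i 1, Pi.single i 1, ?_, by simp⟩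
    ext j
    simp [hw, h0]
  · refine ⟨d, w, c, ?_, ?_⟩
    · ext j; simp [hw]
    · apply mul_left_cancel₀ h0
      rw [mul_one]
      conv_rhs => rw [← hc]
      simp only [dotProduct, Finset.mul_sum, hw]
      exact Finset.sum_congr rfl fun i _ => by ring

lemma content_pair (x y : R) :
    ∃ d x' y' : R, x = d * x' ∧ y = d * y' ∧ IsCoprime x' y' := by
  obtain ⟨d, w, c, h, h1⟩ := content_exists ![x, y]
  refine ⟨d, w 0, w 1, by simpa using congrFun h 0, by simpa using congrFun h 1, c 0, c 1, ?_⟩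
  simp [dotProduct, Fin.sum_univ_two] at h1
  rw [← h1]; ring

lemma decomp {w a b : R} (h : w ∣ a * b) : ∃ s t, w = s * t ∧ s ∣ a ∧ t ∣ b := by
  classical
  let _ : GCDMonoid R := IsBezout.toGCDDomain R
  obtain ⟨s, t, h1, h2, h3⟩ := exists_dvd_and_dvd_of_dvd_mul h
  exact ⟨s, t, h3, h1, h2⟩

end basic

section cond

variable (R : Type*) [CommRing R]

/-- The condition of the theorem. -/
def Cond : Prop := ∀ x y z : R, x ≠ 0 → y ≠ 0 → z ≠ 0 →
        ∃ lam a b : R,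
          (x + lam * y) ∣ y * (1 - a * z) * (1 - b * (1 - z))

/-- Kaplansky's condition. -/
def Kap : Prop := ∀ a b c : R, (∃ u v w, u * a + v * b + w * c = 1) →
  ∃ p q m n : R, p * a * m + (p * b + q * c) * n = 1

end cond

section main

variable {R : Type*} [CommRing R] [IsDomain R] [IsBezout R]

lemma weak_factor (h : Cond R) {x y : R} (z : R) (hxy : IsCoprime x y) (hy : y ≠ 0) :
    ∃ lam s t : R, x + lam * y = s * t ∧ IsCoprime s z ∧ IsCoprime t (1 - z) := by
  by_cases hz : z = 0
  · exact ⟨0, 1, x, by simp, isCoprime_one_left, by simp [hz, isCoprime_one_right]⟩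
  obtain ⟨mu, hx⟩ : ∃ mu, x + mu * y ≠ 0 := by
    by_cases hx : x = 0
    · exact ⟨1, by simpa [hx] using hy⟩
    · exact ⟨0, by simpa using hx⟩
  obtain ⟨lam, a, b, hd⟩ := h (x + mu * y) y z hx hy hz
  have e : x + mu * y + lam * y = x + (mu + lam) * y := by ring
  rw [e, mul_assoc] at hd
  have hc : IsCoprime (x + (mu + lam) * y) y := hxy.add_mul_right_left _
  obtain ⟨s, t, h1, ⟨k, h2⟩, ⟨l, h3⟩⟩ := decomp (hc.dvd_of_dvd_mul_left hd)
  exact ⟨_, s, t, h1, ⟨k, a, by linear_combination -h2⟩, ⟨l, b, by linear_combination -h3⟩⟩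

lemma kap_of_cond (h : Cond R) : Kap R := by
  rintro a b c ⟨u, v, w, huvw⟩
  obtain ⟨g, a0, c0, rfl, rfl, k1, k2, hac⟩ := content_pair a c
  by_cases hg : g = 0
  · subst hg
    exact ⟨1, 0, 0, v, by linear_combination huvw⟩
  have hbg : IsCoprime b g := ⟨v, u * a0 + w * c0, by linear_combination huvw⟩
  -- `z = k2 * c0`, `1 - z = k1 * a0`
  obtain ⟨lam, s, t, hst, hs, ht⟩ := weak_factor h (k2 * c0) hbg hg
  have e1 : 1 - k2 * c0 = k1 * a0 := by linear_combination -hac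
  rw [e1] at ht
  have hstg : IsCoprime (s * t) g := hst ▸ hbg.add_mul_right_left _
  have hsz : IsCoprime s (g * (k2 * c0)) := (hstg.of_mul_left_left).mul_right hs
  have htz : IsCoprime t (g * (k1 * a0)) := (hstg.of_mul_left_right).mul_right ht
  obtain ⟨t2, r, htt⟩ := htz
  obtain ⟨d, s', t', rfl, rfl, hst'⟩ := content_pair s t2
  have hc1 : IsCoprime s' (g * (k2 * c0) * t') :=
    (hsz.of_mul_left_right).mul_right hst'
  obtain ⟨p, q, hpq⟩ := hc1
  -- the row `(p, q)`
  set W := p * (b + lam * g) + q * (g * (k2 * c0)) with hW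
  have hp : IsCoprime p (q * (g * (k2 * c0))) := ⟨s', t', by linear_combination hpq⟩
  have hWp : IsCoprime p W := by
    have := hp.add_mul_left_right (b + lam * g)
    rwa [add_comm] at this
  have hdt : IsCoprime (d * t) (g * (k1 * a0)) := ⟨t', r, by linear_combination htt⟩
  have hWe : W = d * t + (g * (k1 * a0)) * (q * (g * (k2 * c0)) * r) := by
    rw [hW, hst]
    linear_combination (d * t) * hpq - (q * (g * (k2 * c0))) * htt
  have hWa : IsCoprime W (g * (k1 * a0)) := by
    rw [hWe]; exact hdt.add_mul_left_left _
  obtain ⟨m, n, hmn⟩ := hWp.mul_left hWa.symm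
  -- `m * (p * (g * (k1 * a0))) + n * W = 1`
  refine ⟨p, q * k2 + p * lam * k2, k1 * m + n * lam * k1, n, ?_⟩
  rw [hW] at hmn
  linear_combination hmn + (n * p * lam * g) * hac

lemma cond_of_kap (h : Kap R) : Cond R := by
  intro x y z hx hy hz
  obtain ⟨d, x, y, rfl, rfl, x', y', hxy⟩ := content_pair x y
  have hxx : IsCoprime x' y := ⟨x, y', by linear_combination hxy⟩
  obtain ⟨p, q, m, n, hpq⟩ := h (y * (1 - z)) x' (y * z)
    ⟨y', x, y', by linear_combination hxy⟩
  -- `p * x' * n ≡ 1 mod y`, `p` coprime to `z`, `n` coprime to `1 - z`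
  refine ⟨(y' * p * n - x * (p * (1 - z) * m + q * z * n)), q * y * n, p * y * m, ?_⟩
  have e : d * x + ((y' * p * n - x * (p * (1 - z) * m + q * z * n))) * (d * y)
      = d * (p * n) := by
    linear_combination (-d * x) * hpq + (d * p * n) * hxy
  rw [e, mul_assoc]
  have h1 : 1 - q * y * n * z = p * (y * (1 - z) * m + x' * n) := by
    linear_combination -hpq
  have h2 : 1 - p * y * m * (1 - z) = n * (p * x' + q * (y * z)) := by
    linear_combination -hpq
  rw [h1, h2]
  exact ⟨y * (y * (1 - z) * m + x' * n) * (p * x' + q * (y * z)), by ring⟩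

lemma kap_of_edr (h : IsEDR R) : Kap R := by
  rintro a b c ⟨u, v, w, huvw⟩
  obtain ⟨P, Q, hP, hQ, hD⟩ := h 2 2 !![a, b; 0, c]
  obtain ⟨P', hP'⟩ := hP.exists_left_inv
  obtain ⟨Q', hQ'⟩ := hQ.exists_right_inv
  set A : Matrix (Fin 2) (Fin 2) R := !![a, b; 0, c] with hA
  have h01 := hD 0 1 (by simp)
  have h10 := hD 1 0 (by simp)
  set D := P * A * Q with hDd
  have hAD : A = P' * D * Q' := by
    rw [hDd]
    calc A = (P' * P) * A * (Q * Q') := by rw [hP', hQ']; simp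
      _ = _ := by simp only [Matrix.mul_assoc]
  have hij : ∀ i j, A i j = P' i 0 * D 0 0 * Q' 0 j + P' i 1 * D 1 1 * Q' 1 j := by
    intro i j
    conv_lhs => rw [hAD]
    simp [Matrix.mul_apply, Fin.sum_univ_two, h01, h10]
  have ha := hij 0 0
  have hb := hij 0 1
  have hc := hij 1 1
  simp only [hA, Matrix.of_apply, Matrix.cons_val', Matrix.cons_val_zero, Matrix.cons_val_one] at ha hb hc
  obtain ⟨α, β, hαβ⟩ : ∃ α β, α * D 0 0 + β * D 1 1 = 1 := by
    refine ⟨u * (P' 0 0 * Q' 0 0) + v * (P' 0 0 * Q' 0 1) + w * (P' 1 0 * Q' 0 1),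
      u * (P' 0 1 * Q' 1 0) + v * (P' 0 1 * Q' 1 1) + w * (P' 1 1 * Q' 1 1), ?_⟩
    rw [← huvw]
    linear_combination -u * ha - v * hb - w * hc
  have d00 : D 0 0 = P 0 0 * (a * Q 0 0 + b * Q 1 0) + P 0 1 * c * Q 1 0 := by
    simp [hDd, hA, Matrix.mul_apply, Fin.sum_univ_two]; ring
  have d11 : D 1 1 = P 1 0 * (a * Q 0 1 + b * Q 1 1) + P 1 1 * c * Q 1 1 := by
    simp [hDd, hA, Matrix.mul_apply, Fin.sum_univ_two]; ring
  have d01 : 0 = P 0 0 * (a * Q 0 1 + b * Q 1 1) + P 0 1 * c * Q 1 1 := by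
    rw [← h01]; simp [hDd, hA, Matrix.mul_apply, Fin.sum_univ_two]; ring
  have d10 : 0 = P 1 0 * (a * Q 0 0 + b * Q 1 0) + P 1 1 * c * Q 1 0 := by
    rw [← h10]; simp [hDd, hA, Matrix.mul_apply, Fin.sum_univ_two]; ring
  refine ⟨P 0 0 + P 1 0, P 0 1 + P 1 1, Q 0 0 * α + Q 0 1 * β, Q 1 0 * α + Q 1 1 * β, ?_⟩
  linear_combination hαβ - α * d00 - β * d11 - β * d01 - α * d10

/-- Content extraction for matrices. -/
lemma matrix_content (h : Kap R) (n : ℕ) : ∀ (m : ℕ) (A : Matrix (Fin (m + 1)) (Fin (n + 1)) R),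
    ∃ (d : R) (B : Matrix (Fin (m + 1)) (Fin (n + 1)) R) (r : Fin (m + 1) → R)
      (c : Fin (n + 1) → R), A = d • B ∧ r ⬝ᵥ (B *ᵥ c) = 1 := by
  intro m
  induction m with
  | zero =>
    intro A
    obtain ⟨d, w, c, h1, h2⟩ := content_exists (A 0)
    refine ⟨d, fun _ => w, fun _ => 1, c, ?_, ?_⟩
    · ext i j
      obtain rfl : i = 0 := by ext; omega
      rw [h1]; rfl
    · simpa [dotProduct, Matrix.mulVec] using h2
  | succ m ih =>
    intro A
    obtain ⟨e, B, r, k, hB, hk⟩ := ih (fun i => A i.succ)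
    obtain ⟨d, we, y, h1, h2⟩ := content_exists (Fin.cons e (A 0) : Fin (n + 2) → R)
    set w : Fin (n + 1) → R := fun j => we j.succ with hw
    set e' := we 0 with he'
    have hA0 : ∀ j, A 0 j = d * w j := fun j => by simpa using congrFun h1 j.succ
    have hee : e = d * e' := by simpa using congrFun h1 0
    have hA1 : ∀ i j, A (Fin.succ i) j = e * B i j := fun i j => congrFun (congrFun hB i) j
    have hun : e' * y 0 + w ⬝ᵥ (fun j => y j.succ) = 1 := by
      rw [← h2]; simp [dotProduct, Fin.sum_univ_succ, hw, he']
    set y' : Fin (n + 1) → R := fun j => y j.succ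
    set v := r ᵥ* B with hv
    have hvk : v ⬝ᵥ k = 1 := by rw [hv, ← Matrix.dotProduct_mulVec, hk]
    have key : ∃ p q c, p * (w ⬝ᵥ c) + q * e' * (v ⬝ᵥ c) = 1 := by
      obtain ⟨f, u, l, hu, hl⟩ := content_exists (w - (w ⬝ᵥ k) • v)
      have hw' : w = (w ⬝ᵥ k) • v + f • u := by rw [← hu]; abel
      have hwc : ∀ c, w ⬝ᵥ c = (w ⬝ᵥ k) * (v ⬝ᵥ c) + f * (u ⬝ᵥ c) := by
        intro c
        conv_lhs => rw [hw']
        simp [add_dotProduct, smul_dotProduct]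
      set w1 := w ⬝ᵥ k with hw1
      by_cases hf : f = 0
      · refine ⟨v ⬝ᵥ y', y 0, k, ?_⟩
        have := hwc y'
        rw [hf] at this
        rw [hvk]
        linear_combination hun - this
      · have huk : u ⬝ᵥ k = 0 := by
          have := hwc k
          rw [hvk, ← hw1] at this
          have h3 : f * (u ⬝ᵥ k) = 0 := by linear_combination -this
          exact (mul_eq_zero.1 h3).resolve_left hf
        obtain ⟨p, q, a, b, hab⟩ := h f w1 e'
          ⟨u ⬝ᵥ y', v ⬝ᵥ y', y 0, by linear_combination hun - hwc y'⟩
        refine ⟨p, q, a • (l - (v ⬝ᵥ l) • k) + b • k, ?_⟩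
        rw [hwc]
        simp only [dotProduct_add, dotProduct_smul, dotProduct_sub, smul_eq_mul, hvk, huk, hl]
        linear_combination hab
    obtain ⟨p, q, c, hpq⟩ := key
    refine ⟨d, Fin.cons w (fun i => e' • B i), Fin.cons p (q • r), c, ?_, ?_⟩
    · ext i j
      refine Fin.cases ?_ (fun i => ?_) i
      · rw [hA0]; rfl
      · rw [hA1, hee, mul_assoc]; rfl
    · rw [← hpq, hv, ← Matrix.dotProduct_mulVec]
      simp only [dotProduct, Fin.sum_univ_succ (n := m + 1), Fin.cons_zero, Fin.cons_succ,
        Matrix.mulVec, Pi.smul_apply, smul_eq_mul, Finset.mul_sum]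
      congr 1
      refine Finset.sum_congr rfl fun i _ => Finset.sum_congr rfl fun j _ => by ring

end main

section blocks

variable {R : Type*} [CommRing R]

/-- Block matrix `1 ⊕ M`. -/
def L {m n : ℕ} (M : Matrix (Fin m) (Fin n) R) : Matrix (Fin (m + 1)) (Fin (n + 1)) R :=
  Matrix.of (Fin.cons (Fin.cons 1 0) (fun i => Fin.cons 0 (M i)))

/-- Row shear. -/
def E {n : ℕ} (w : Fin n → R) : Matrix (Fin (n + 1)) (Fin (n + 1)) R :=
  Matrix.of (Fin.cons (Fin.cons 1 w) (fun i => Fin.cons 0 ((1 : Matrix (Fin n) (Fin n) R) i)))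

/-- Block matrix `[[a,b],[c,d]] ⊕ 1`. -/
def T (n : ℕ) (a b c d : R) : Matrix (Fin (n + 2)) (Fin (n + 2)) R :=
  Matrix.of (Fin.cons (Fin.cons a (Fin.cons b 0)) (Fin.cons (Fin.cons c (Fin.cons d 0))
    (fun i => Fin.cons 0 (Fin.cons 0 ((1 : Matrix (Fin n) (Fin n) R) i)))))

lemma L_mul {m n k : ℕ} (M : Matrix (Fin m) (Fin n) R) (N : Matrix (Fin n) (Fin k) R) :
    L M * L N = L (M * N) := by
  ext i j
  refine Fin.cases ?_ (fun i => ?_) i <;> refine Fin.cases ?_ (fun j => ?_) j <;>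
    simp [L, Matrix.mul_apply, Fin.sum_univ_succ]

lemma one_eq {n : ℕ} : (1 : Matrix (Fin (n + 1)) (Fin (n + 1)) R) = L 1 := by
  ext i j
  refine Fin.cases ?_ (fun i => ?_) i <;> refine Fin.cases ?_ (fun j => ?_) j <;>
    simp [L, Matrix.one_apply, Fin.succ_ne_zero, (Fin.succ_ne_zero _).symm]

lemma L_unit {n : ℕ} {M : Matrix (Fin n) (Fin n) R} (h : IsUnit M) : IsUnit (L M) := by
  obtain ⟨N, hN⟩ := h.exists_right_inv
  exact IsUnit.of_mul_eq_one (L N) (by rw [L_mul, hN, one_eq])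

lemma E_unit {n : ℕ} (w : Fin n → R) : IsUnit (E w) := by
  refine IsUnit.of_mul_eq_one (E (-w)) ?_
  rw [one_eq]
  ext i j
  refine Fin.cases ?_ (fun i => ?_) i <;> refine Fin.cases ?_ (fun j => ?_) j <;>
    simp [L, E, Matrix.mul_apply, Fin.sum_univ_succ, Matrix.one_apply]

lemma T_unit (n : ℕ) {a b c d : R} (h : a * d - b * c = 1) : IsUnit (T n a b c d) := by
  refine IsUnit.of_mul_eq_one (T n d (-b) (-c) a) ?_
  rw [one_eq, one_eq]
  ext i j
  refine Fin.cases ?_ (fun i => Fin.cases ?_ (fun i => ?_) i) i <;>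
    refine Fin.cases ?_ (fun j => Fin.cases ?_ (fun j => ?_) j) j <;>
    simp [L, T, Matrix.mul_apply, Fin.sum_univ_succ, Matrix.one_apply] <;>
    first | linear_combination h | linear_combination (0 : R)

end blocks

section final

variable {R : Type*} [CommRing R] [IsDomain R] [IsBezout R]

lemma hermite : ∀ (n : ℕ) (v : Fin (n + 1) → R),
    ∃ (P : Matrix (Fin (n + 1)) (Fin (n + 1)) R) (d : R), IsUnit P ∧
      P *ᵥ v = Pi.single 0 d := by
  intro n
  induction n with
  | zero =>
    intro v
    refine ⟨1, v 0, isUnit_one, ?_⟩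
    ext i
    obtain rfl : i = 0 := by ext; omega
    simp
  | succ n ih =>
    intro v
    obtain ⟨P, d, hP, hd⟩ := ih (fun i => v i.succ)
    obtain ⟨g, x, y, hx, hy, α, β, hαβ⟩ := content_pair (v 0) d
    refine ⟨T n α β (-y) x * L P, g, (T_unit n (by linear_combination hαβ)).mul (L_unit hP), ?_⟩
    have h1 : L P *ᵥ v = Fin.cons (v 0) (Pi.single 0 d : Fin (n + 1) → R) := by
      rw [← hd]
      ext i
      refine Fin.cases ?_ (fun i => ?_) i <;>
        simp [L, Matrix.mulVec, dotProduct, Fin.sum_univ_succ (n := n + 1)]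
    rw [← Matrix.mulVec_mulVec, h1]
    ext i
    refine Fin.cases ?_ (fun i => Fin.cases ?_ (fun i => ?_) i) i
    · simp [T, Matrix.mulVec, dotProduct, Fin.sum_univ_succ, hx, hy]
      linear_combination g * hαβ
    · simp [T, Matrix.mulVec, dotProduct, Fin.sum_univ_succ, hx, hy]
      ring
    · simp [T, Matrix.mulVec, dotProduct, Fin.sum_univ_succ]

lemma complete {n : ℕ} (v w : Fin (n + 1) → R) (h : w ⬝ᵥ v = 1) :
    ∃ (P : Matrix (Fin (n + 1)) (Fin (n + 1)) R), IsUnit P ∧ P *ᵥ v = Pi.single 0 1 := by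
  obtain ⟨P, d, hP, hd⟩ := hermite n v
  obtain ⟨P', hP'⟩ := hP.exists_left_inv
  have hv : v = P' *ᵥ Pi.single 0 d := by
    rw [← hd, Matrix.mulVec_mulVec, hP', Matrix.one_mulVec]
  have hu : ((w ᵥ* P') 0) * d = 1 := by
    rw [hv, Matrix.dotProduct_mulVec] at h
    simpa using h
  refine ⟨((w ᵥ* P') 0) • P, ?_, ?_⟩
  · obtain ⟨P'', hP''⟩ := hP.exists_right_inv
    refine IsUnit.of_mul_eq_one (d • P'') ?_
    rw [Matrix.smul_mul, Matrix.mul_smul, hP'', smul_smul, hu, one_smul]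
  · rw [Matrix.smul_mulVec, hd, ← Pi.single_smul, smul_eq_mul, hu]

lemma edr_of_kap (h : Kap R) : IsEDR R := by
  intro m
  induction m with
  | zero => exact fun n A => ⟨1, 1, isUnit_one, isUnit_one, fun i => i.elim0⟩
  | succ m ih =>
    intro n A
    cases n with
    | zero => exact ⟨1, 1, isUnit_one, isUnit_one, fun _ j => j.elim0⟩
    | succ n =>
      obtain ⟨d, B, r, c, rfl, hrc⟩ := matrix_content h n m A
      obtain ⟨P, hP, hPv⟩ := complete _ _ hrc
      obtain ⟨Q', hQ', hQv⟩ := complete c (r ᵥ* B) (by rw [← Matrix.dotProduct_mulVec, hrc])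
      obtain ⟨Q, hQQ⟩ := hQ'.exists_left_inv
      have hQ : IsUnit Q := IsUnit.of_mul_eq_one Q' hQQ
      have hc : Q *ᵥ Pi.single 0 1 = c := by
        rw [← hQv, Matrix.mulVec_mulVec, hQQ, Matrix.one_mulVec]
      set C := P * B * Q with hC
      have hC0 : ∀ i, C i 0 = (Pi.single 0 1 : Fin (m + 1) → R) i := by
        intro i
        rw [← hPv, ← hc, Matrix.mulVec_mulVec, Matrix.mulVec_mulVec, ← hC]
        simp
      obtain ⟨P1, Q1, hP1, hQ1, hD⟩ := ih n (C.submatrix Fin.succ Fin.succ)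
      have hCE : C * E (fun j => -C 0 j.succ) = L (C.submatrix Fin.succ Fin.succ) := by
        ext i j
        refine Fin.cases ?_ (fun i => ?_) i <;> refine Fin.cases ?_ (fun j => ?_) j <;>
          simp [L, E, Matrix.mul_apply, Fin.sum_univ_succ, Matrix.one_apply, hC0]
      refine ⟨L P1 * P, Q * E (fun j => -C 0 j.succ) * L Q1, (L_unit hP1).mul hP,
        (hQ.mul (E_unit _)).mul (L_unit hQ1), ?_⟩
      have hfin : L P1 * P * (d • B) * (Q * E (fun j => -C 0 j.succ) * L Q1)
          = d • L (P1 * C.submatrix Fin.succ Fin.succ * Q1) := by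
        rw [← L_mul, ← L_mul, ← hCE, hC]
        simp only [Matrix.mul_smul, Matrix.smul_mul, Matrix.mul_assoc]
      rw [hfin]
      intro i j
      refine Fin.cases ?_ (fun i => ?_) i <;> refine Fin.cases ?_ (fun j => ?_) j
      · simp
      · simp [L]
      · simp [L]
      · intro hij
        have := hD i j (by simpa using hij)
        simp [L, this]

end final

end BezoutEDR

/-- A Bézout domain is an elementary divisor ring iff for any nonzero
`x, y, z` there exist `λ, a, b` with `x + λ·y ∣ y·(1 - a·z)·(1 - b·(1 - z))`. -/
theorem bezout_domain_isEDR_iff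
    {R : Type*} [CommRing R] [IsDomain R] [IsBezout R] :
    IsEDR R ↔
      ∀ x y z : R, x ≠ 0 → y ≠ 0 → z ≠ 0 →
        ∃ lam a b : R,
          (x + lam * y) ∣ y * (1 - a * z) * (1 - b * (1 - z)) :=
  ⟨fun h => BezoutEDR.cond_of_kap (BezoutEDR.kap_of_edr h),
    fun h => BezoutEDR.edr_of_kap (BezoutEDR.kap_of_cond h)⟩
end

section
/- The ring R = ℤ + X·ℚ[X], the subring of ℚ[X] consisting of all polynomials whose constant coefficient is an integer, does not have almost stable range 1: the ideal I = X·ℚ[X] of R is nonzero, and the quotient R/I does not have stable range 1 (indeed R/I is isomorphic to ℤ, and there is no integer m with 2 + 5·m a unit of ℤ). -/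
open Polynomial

/-- A commutative ring has stable range 1. -/
def StableRangeOne (R : Type*) [CommRing R] : Prop :=
  ∀ x y : R, Ideal.span {x, y} = ⊤ → ∃ t : R, IsUnit (x + t * y)

/-- The subring `ℤ + X·ℚ[X]` of `ℚ[X]`: polynomials whose constant
coefficient is an integer. -/
noncomputable def ZplusXQX : Subring (Polynomial ℚ) :=
  Subring.comap (Polynomial.constantCoeff : Polynomial ℚ →+* ℚ)
    (Int.castRingHom ℚ).range

/-- The ideal `X·ℚ[X]` of `ℤ + X·ℚ[X]`: polynomials with zero constant
coefficient. -/
noncomputable def XQX : Ideal ZplusXQX where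
  carrier := {p | (p : Polynomial ℚ).coeff 0 = 0}
  zero_mem' := by simp
  add_mem' := by
    intro p q hp hq
    simp_all [Polynomial.coeff_add]
  smul_mem' := by
    intro c p hp
    have : ((c • p : ZplusXQX) : Polynomial ℚ) = (c : Polynomial ℚ) * p := rfl
    simp_all [Polynomial.mul_coeff_zero]

theorem aux_bij : Function.Bijective (Int.castRingHom (ZplusXQX ⧸ XQX)) := by
  constructor
  · rw [injective_iff_map_eq_zero]
    intro n hn
    have h : (Ideal.Quotient.mk XQX) ((n : ℤ) : ZplusXQX) = 0 := by
      rw [map_intCast]; exact hn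
    rw [Ideal.Quotient.eq_zero_iff_mem] at h
    have h2 : (((n : ZplusXQX)) : Polynomial ℚ).coeff 0 = 0 := h
    have h3 : (((n : ZplusXQX)) : Polynomial ℚ) = C (n : ℚ) := by simp
    rw [h3, coeff_C_zero] at h2
    exact_mod_cast h2
  · intro q
    obtain ⟨p, rfl⟩ := Ideal.Quotient.mk_surjective q
    obtain ⟨n, hn⟩ := p.2
    refine ⟨n, ?_⟩
    have e : (Int.castRingHom (ZplusXQX ⧸ XQX)) n
        = (Ideal.Quotient.mk XQX) ((n : ℤ) : ZplusXQX) := by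
      rw [map_intCast]; rfl
    rw [e, Ideal.Quotient.eq]
    change ((((n : ZplusXQX)) - p : ZplusXQX) : Polynomial ℚ).coeff 0 = 0
    have h3 : (((n : ZplusXQX)) : Polynomial ℚ) = C (n : ℚ) := by simp
    have hn' : (n : ℚ) = (p : Polynomial ℚ).coeff 0 := hn
    rw [AddSubgroupClass.coe_sub, h3, coeff_sub, coeff_C_zero, hn', sub_self]

theorem aux_unit (m : ℤ) : ¬ IsUnit (2 + 5 * m) := by
  rw [Int.isUnit_iff]
  omega

theorem aux_ne_bot : XQX ≠ ⊥ := by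
  intro h
  have hX : (X : Polynomial ℚ) ∈ ZplusXQX := ⟨0, by simp⟩
  have hm : (⟨X, hX⟩ : ZplusXQX) ∈ XQX := by
    change (X : Polynomial ℚ).coeff 0 = 0
    simp
  rw [h, Ideal.mem_bot] at hm
  exact X_ne_zero (congrArg Subtype.val hm)

theorem aux_not : ¬ StableRangeOne (ZplusXQX ⧸ XQX) := by
  intro h
  let e := RingEquiv.ofBijective _ aux_bij
  obtain ⟨t, ht⟩ := h 2 5 (by
    rw [Ideal.eq_top_iff_one, Ideal.mem_span_pair]
    exact ⟨-2, 1, by norm_num⟩)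
  have h2 := ht.map e.symm
  rw [map_add, map_mul, map_ofNat, map_ofNat, mul_comm] at h2
  exact aux_unit _ h2

/-- `ℤ + X·ℚ[X]` does not have almost stable range 1: the ideal `X·ℚ[X]` is
nonzero, the quotient by it does not have stable range 1 (indeed the quotient
is isomorphic to `ℤ` and no integer `m` makes `2 + 5·m` a unit), and hence not
every quotient by a nonzero ideal has stable range 1. -/
theorem ZplusXQX_not_almost_stable_range_one :
    XQX ≠ ⊥ ∧
    ¬ StableRangeOne (ZplusXQX ⧸ XQX) ∧
    Nonempty ((ZplusXQX ⧸ XQX) ≃+* ℤ) ∧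
    (∀ m : ℤ, ¬ IsUnit (2 + 5 * m)) ∧
    ¬ (∀ I : Ideal ZplusXQX, I ≠ ⊥ → StableRangeOne (ZplusXQX ⧸ I)) := by
  exact ⟨aux_ne_bot, aux_not, ⟨(RingEquiv.ofBijective _ aux_bij).symm⟩, aux_unit,
    fun h => aux_not (h _ aux_ne_bot)⟩
end
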